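/- Let A be a 9-dimensional local symmetric algebra over an algebraically closed field k of characteristic 3 with Z(A) ≅ Z(B) for B = k⟨X,Y⟩/⟨X³,Y³,XY+YX⟩. Then the radical layer dimensions of A are either (dim J/J², dim J²/J³, dim J³/J⁴, dim J⁴) = (3,2,2,1) or (2,3,2,1). -/

import Mathlib

open Module FreeAlgebra

noncomputable section

def IsSymmAlg (k : Type) [Field k] (C : Type) [Ring C] [Algebra k C] : Prop :=
  ∃ s : C →ₗ[k] k, (∀ x y : C, s (x * y) = s (y * x)) ∧
    ∀ I : Ideal C, (∀ x ∈ I, s x = 0) → I = ⊥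

def radSub (k : Type) [Field k] (C : Type) [Ring C] [Algebra k C] : Submodule k C :=
  Submodule.span k {a : C | ¬ IsUnit a}

def socSub (k : Type) [Field k] (C : Type) [Ring C] [Algebra k C] : Submodule k C where
  carrier := {a : C | ∀ b : C, ¬ IsUnit b → b * a = 0 ∧ a * b = 0}
  add_mem' := by
    intro a b ha hb c hc
    obtain ⟨h1, h2⟩ := ha c hc
    obtain ⟨h3, h4⟩ := hb c hc
    constructor
    · rw [mul_add, h1, h3, add_zero]
    · rw [add_mul, h2, h4, add_zero]
  zero_mem' := by
    intro b hb
    constructor <;> simp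
  smul_mem' := by
    intro r a ha c hc
    obtain ⟨h1, h2⟩ := ha c hc
    constructor
    · rw [Algebra.mul_smul_comm, h1, smul_zero]
    · rw [Algebra.smul_mul_assoc, h2, smul_zero]

/-- The relations X³ = 0, Y³ = 0, XY + YX = 0 in the free algebra on two
generators. -/
def Brel (k : Type) [Field k] :
    FreeAlgebra k (Fin 2) → FreeAlgebra k (Fin 2) → Prop := fun a b =>
  b = 0 ∧ (a = ι k (0 : Fin 2) ^ 3 ∨ a = ι k (1 : Fin 2) ^ 3 ∨
    a = ι k (0 : Fin 2) * ι k (1 : Fin 2) + ι k (1 : Fin 2) * ι k (0 : Fin 2))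

/-- The quantum complete intersection B = k⟨X,Y⟩/⟨X³, Y³, XY+YX⟩. -/
abbrev Balg (k : Type) [Field k] := RingQuot (Brel k)

/-- The image of X in B. -/
def xB (k : Type) [Field k] : Balg k := RingQuot.mkAlgHom k (Brel k) (ι k 0)

/-- The image of Y in B. -/
def yB (k : Type) [Field k] : Balg k := RingQuot.mkAlgHom k (Brel k) (ι k 1)


structure Good {k A : Type} [Field k] [Ring A] [Algebra k A] (J R : Submodule k A)
    (s : A →ₗ[k] k) : Prop where
  top : ∀ a : A, ∃ c : k, a - algebraMap k A c ∈ J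
  ml : ∀ a, ∀ x ∈ J, a * x ∈ J
  mr : ∀ a, ∀ x ∈ J, x * a ∈ J
  nil : ∃ m, J ^ m = ⊥
  symm : ∀ x y, s (x * y) = s (y * x)
  nd : ∀ x, (∀ y, s (y * x) = 0) → x = 0
  dimA : finrank k A = 9
  dimJ : finrank k J = 8
  RJ : R ≤ J
  Rc : ∀ r ∈ R, ∀ a, r * a = a * r
  Rmax : ∀ z ∈ J, (∀ a, z * a = a * z) → z ∈ R
  dimR : finrank k R = 5
  Rt : ∃ t, ∀ r ∈ R, ∀ r' ∈ R, ∃ c : k, r * r' = c • t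
  Rann : ∀ N : Submodule k A, N ≤ R → (∀ r ∈ N, ∀ r' ∈ R, r * r' = 0) → finrank k N ≤ 3

section Abstract

set_option linter.unusedSectionVars false
set_option linter.unusedVariables false

variable {k A : Type} [Field k] [Ring A] [Algebra k A] [FiniteDimensional k A]

theorem exists_gen (U V : Submodule k A) (hUV : U ≤ V) (h : finrank k V ≤ finrank k U + 1) :
    ∃ x ∈ V, V ≤ U ⊔ Submodule.span k {x} := by
  by_cases hV : V ≤ U
  · exact ⟨0, V.zero_mem, hV.trans le_sup_left⟩
  · obtain ⟨x, hx, hxU⟩ := Set.not_subset.1 hV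
    refine ⟨x, hx, ?_⟩
    have h1 : U ⊔ Submodule.span k {x} ≤ V :=
      sup_le hUV ((Submodule.span_singleton_le_iff_mem x V).2 hx)
    have h2 : U < U ⊔ Submodule.span k {x} := by
      refine lt_of_le_of_ne le_sup_left ?_
      intro h
      apply hxU
      rw [h]
      exact Submodule.mem_sup_right (Submodule.mem_span_singleton_self x)
    have h3 := Submodule.finrank_lt_finrank_of_lt h2
    exact (Submodule.eq_of_le_of_finrank_le h1 (by omega)).ge

/-- the socle -/
def socJ (J : Submodule k A) : Submodule k A where
  carrier := {x | ∀ y ∈ J, y * x = 0 ∧ x * y = 0}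
  add_mem' := by
    intro a b ha hb y hy
    simp [mul_add, add_mul, ha y hy, hb y hy]
  zero_mem' := by
    intro y hy
    simp
  smul_mem' := by
    intro c a ha y hy
    simp [ha y hy]

/-- the commutator space -/
def comSp (k A : Type) [Field k] [Ring A] [Algebra k A] : Submodule k A :=
  Submodule.span k {x | ∃ a b : A, x = a * b - b * a}

theorem com_mem (a b : A) : a * b - b * a ∈ comSp k A := Submodule.subset_span ⟨a, b, rfl⟩

variable {J R : Submodule k A} {s : A →ₗ[k] k}

namespace Good

theorem pow_anti (g : Good J R s) {m n : ℕ} (hm : 1 ≤ m) (hmn : m ≤ n) : J ^ n ≤ J ^ m := by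
  induction n, hmn using Nat.le_induction with
  | base => exact le_rfl
  | succ n hn ih =>
    refine le_trans ?_ ih
    obtain ⟨n, rfl⟩ : ∃ n', n = n' + 1 := ⟨n - 1, by omega⟩
    rw [pow_succ, pow_succ, mul_assoc]
    exact mul_le_mul' le_rfl (Submodule.mul_le.2 fun a _ b hb => g.ml a b hb)

theorem pow_le_J (g : Good J R s) {m : ℕ} (hm : 1 ≤ m) : J ^ m ≤ J := by
  simpa using g.pow_anti le_rfl hm

theorem pow_mr (g : Good J R s) {m : ℕ} (hm : 1 ≤ m) (a x : A) (hx : x ∈ J ^ m) :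
    x * a ∈ J ^ m := by
  obtain ⟨n, rfl⟩ : ∃ n', m = n' + 1 := ⟨m - 1, by omega⟩
  rw [pow_succ] at hx ⊢
  refine Submodule.mul_induction_on hx ?_ ?_
  · intro m hm n hn
    rw [mul_assoc]
    exact Submodule.mul_mem_mul hm (g.mr a n hn)
  · intro x y hx hy
    rw [add_mul]
    exact add_mem hx hy

theorem pow_ml (g : Good J R s) {m : ℕ} (hm : 1 ≤ m) (a x : A) (hx : x ∈ J ^ m) :
    a * x ∈ J ^ m := by
  obtain ⟨n, rfl⟩ : ∃ n', m = n' + 1 := ⟨m - 1, by omega⟩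
  rw [pow_succ'] at hx ⊢
  refine Submodule.mul_induction_on hx ?_ ?_
  · intro m hm n hn
    rw [← mul_assoc]
    exact Submodule.mul_mem_mul (g.ml a m hm) hn
  · intro x y hx hy
    rw [mul_add]
    exact add_mem hx hy

theorem pow_lt (g : Good J R s) {m : ℕ} (hm : 1 ≤ m) (h : J ^ m ≠ ⊥) : J ^ (m + 1) < J ^ m := by
  refine lt_of_le_of_ne (g.pow_anti hm (by omega)) fun he => h ?_
  have : ∀ r, J ^ (m + r) = J ^ m := by
    intro r
    induction r with
    | zero => rfl
    | succ r ih => rw [← add_assoc, pow_succ, ih, ← pow_succ, he]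
  obtain ⟨n, hn⟩ := g.nil
  rw [← this n, pow_add, hn, Submodule.mul_bot]

theorem dim_lt (g : Good J R s) {m : ℕ} (hm : 1 ≤ m) (h : finrank k ↥(J ^ m) ≠ 0) :
    finrank k ↥(J ^ (m + 1)) < finrank k ↥(J ^ m) := by
  apply Submodule.finrank_lt_finrank_of_lt
  apply g.pow_lt hm
  intro h0
  rw [h0] at h
  simp at h

theorem soc_zero (g : Good J R s) (x : A) (hx : x ∈ socJ J) (h : s x = 0) : x = 0 := by
  apply g.nd
  intro y
  obtain ⟨c, hc⟩ := g.top y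
  have h1 := (hx _ hc).1
  have : y * x = c • x := by
    rw [sub_mul, sub_eq_zero] at h1
    rw [h1, Algebra.smul_def]
  rw [this, map_smul, h, smul_zero]

theorem s_com (g : Good J R s) (x : A) (hx : x ∈ comSp k A) : s x = 0 := by
  have : comSp k A ≤ LinearMap.ker s := by
    refine Submodule.span_le.2 ?_
    rintro _ ⟨a, b, rfl⟩
    simp [g.symm a b]
  exact this hx

theorem com_soc (g : Good J R s) (x : A) (hx : x ∈ comSp k A) (h : x ∈ socJ J) : x = 0 :=
  g.soc_zero x h (g.s_com x hx)

theorem dim_soc (g : Good J R s) : finrank k (socJ J) ≤ 1 := by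
  have : Function.Injective (s.domRestrict (socJ J)) := by
    rw [← LinearMap.ker_eq_bot, LinearMap.ker_eq_bot']
    rintro ⟨x, hx⟩ h
    have := g.soc_zero x hx (by simpa using h)
    simpa using this
  simpa using LinearMap.finrank_le_finrank_of_injective this

theorem com_le (g : Good J R s) : comSp k A ≤ J ^ 2 := by
  refine Submodule.span_le.2 ?_
  rintro _ ⟨a, b, rfl⟩
  obtain ⟨c, hc⟩ := g.top a
  obtain ⟨d, hd⟩ := g.top b
  have : a * b - b * a = (a - algebraMap k A c) * (b - algebraMap k A d)
      - (b - algebraMap k A d) * (a - algebraMap k A c) := by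
    simp only [sub_mul, mul_sub, Algebra.commutes c b, Algebra.commutes d a,
      Algebra.commutes c (algebraMap k A d)]
    abel
  rw [this, pow_two]
  exact sub_mem (Submodule.mul_mem_mul hc hd) (Submodule.mul_mem_mul hd hc)

theorem le_soc (g : Good J R s) {m : ℕ} (h : J ^ (m + 1) = ⊥) : J ^ m ≤ socJ J := by
  intro x hx y hy
  constructor
  · have : y * x ∈ J ^ (m + 1) := by rw [pow_succ']; exact Submodule.mul_mem_mul hy hx
    rwa [h, Submodule.mem_bot] at this
  · have : x * y ∈ J ^ (m + 1) := by rw [pow_succ]; exact Submodule.mul_mem_mul hx hy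
    rwa [h, Submodule.mem_bot] at this

theorem soc_le (g : Good J R s) {m : ℕ} (hm : 1 ≤ m) (h : J ^ m ≠ ⊥) : socJ J ≤ J ^ m := by
  -- the last nonzero power is in the socle, hence equal to it
  classical
  have hex := g.nil
  have h0 := Nat.find_spec hex
  have h1 : m < Nat.find hex := by
    by_contra hlt
    apply h
    have hne : Nat.find hex ≠ 0 := by
      intro hz
      rw [hz, pow_zero] at h0
      apply h
      have : (1 : A) ∈ (⊥ : Submodule k A) := h0 ▸ Submodule.one_le.1 le_rfl
      rw [Submodule.mem_bot] at this
      rw [eq_bot_iff]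
      intro x _
      rw [Submodule.mem_bot, ← mul_one x, this, mul_zero]
    have := g.pow_anti (Nat.one_le_iff_ne_zero.2 hne) (not_lt.1 hlt)
    rw [h0] at this
    exact le_bot_iff.1 this
  obtain ⟨n, hn⟩ : ∃ n, Nat.find hex = n + 1 := ⟨Nat.find hex - 1, by omega⟩
  have h2 : J ^ n ≠ ⊥ := Nat.find_min hex (by omega)
  rw [hn] at h0
  have h3 := g.le_soc h0
  have h4 : 1 ≤ finrank k ↥(J ^ n) := Submodule.one_le_finrank_iff.2 h2
  have := Submodule.eq_of_le_of_finrank_le h3 (g.dim_soc.trans h4)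
  rw [← this]
  exact g.pow_anti hm (by omega)

theorem dim_soc_eq (g : Good J R s) {m : ℕ} (hm : 1 ≤ m) (h : J ^ m ≠ ⊥) :
    finrank k (socJ J) = 1 := by
  refine le_antisymm g.dim_soc ?_
  rw [Submodule.one_le_finrank_iff]
  obtain ⟨n, hn⟩ := g.nil
  by_contra hb
  have : ∀ r, J ^ (m + r) ≠ ⊥ := by
    intro r
    induction r with
    | zero => exact h
    | succ r ih =>
      intro h0
      have := g.le_soc (m := m + r) h0
      rw [hb] at this
      exact ih (le_bot_iff.1 this)
  exact this n (by rw [pow_add, hn, Submodule.mul_bot])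

/-- the bilinear form -/
def frm (s : A →ₗ[k] k) : LinearMap.BilinForm k A :=
  (LinearMap.mul k A).compr₂ s

theorem frm_apply (x y : A) : frm s x y = s (x * y) := rfl

theorem frm_nd (g : Good J R s) : (frm s).Nondegenerate := by
  constructor
  · intro x hx
    apply g.nd
    intro y
    rw [g.symm]
    exact hx y
  · intro x hx
    apply g.nd
    exact hx

theorem orth_com (g : Good J R s) : (frm s).orthogonal (comSp k A) ≤ (1 : Submodule k A) ⊔ R := by
  intro z hz
  rw [LinearMap.BilinForm.mem_orthogonal_iff] at hz
  have hc : ∀ a, z * a = a * z := by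
    intro a
    rw [← sub_eq_zero]
    apply g.nd
    intro y
    have h := hz _ (com_mem (k := k) a y)
    rw [frm_apply, sub_mul, map_sub, sub_eq_zero] at h
    rw [mul_sub, map_sub, sub_eq_zero, ← mul_assoc, ← mul_assoc, ← h, g.symm, ← mul_assoc]
  obtain ⟨c, hcz⟩ := g.top z
  have : z = algebraMap k A c + (z - algebraMap k A c) := by abel
  rw [this]
  refine add_mem (Submodule.mem_sup_left (Submodule.algebraMap_mem c)) (Submodule.mem_sup_right ?_)
  apply g.Rmax _ hcz
  intro a
  rw [sub_mul, mul_sub, hc a, Algebra.commutes c a]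

theorem dim_com (g : Good J R s) : 3 ≤ finrank k (comSp k A) := by
  have h1 := LinearMap.BilinForm.finrank_orthogonal g.frm_nd (comSp k A)
  have h2 := Submodule.finrank_mono g.orth_com
  have h3 := Submodule.finrank_add_le_finrank_add_finrank (1 : Submodule k A) R
  have h4 : finrank k (1 : Submodule k A) ≤ 1 := by
    rw [Submodule.one_eq_span]
    exact (finrank_span_le_card _).trans (by simp)
  rw [g.dimA] at h1
  have := g.dimR
  omega

theorem dim_com_soc (g : Good J R s) {m : ℕ} (hm : 1 ≤ m) (h : J ^ m ≠ ⊥) :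
    4 ≤ finrank k ↥(comSp k A ⊔ socJ J) := by
  have h1 := Submodule.finrank_sup_add_finrank_inf_eq (comSp k A) (socJ J)
  have h2 : comSp k A ⊓ socJ J = ⊥ := by
    rw [eq_bot_iff]
    rintro x ⟨hx, hx'⟩
    exact g.com_soc x hx hx'
  rw [h2, g.dim_soc_eq hm h] at h1
  simp only [finrank_bot] at h1
  have := g.dim_com
  omega

/-- If `J ^ (i+2) = 0`, then `J ^ i` is in the second socle. -/
theorem dim_soc2 (g : Good J R s) {m : ℕ} (h : J ^ (m + 2) = ⊥) :
    finrank k ↥(J ^ m) + finrank k ↥(J ^ 2) ≤ 9 := by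
  have h1 := LinearMap.BilinForm.finrank_orthogonal g.frm_nd (J ^ 2)
  have h2 : J ^ m ≤ (frm s).orthogonal (J ^ 2) := by
    intro x hx
    rw [LinearMap.BilinForm.mem_orthogonal_iff]
    intro y hy
    rw [frm_apply, g.symm]
    have : x * y ∈ J ^ (m + 2) := by rw [pow_add]; exact Submodule.mul_mem_mul hx hy
    rw [h, Submodule.mem_bot] at this
    rw [this, map_zero]
  have h3 := Submodule.finrank_mono h2
  have h4 := Submodule.finrank_le (J ^ 2)
  rw [g.dimA] at h1 h4
  omega

/-- The annihilator of `J ^ 2` is in `R`. -/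
theorem soc2 (g : Good J R s) (h : J ^ 2 ≠ ⊥) :
    (frm s).orthogonal (J ^ 2) ≤ R ∧ ∀ x ∈ (frm s).orthogonal (J ^ 2), ∀ y ∈ J ^ 2, x * y = 0 := by
  have hann : ∀ x ∈ (frm s).orthogonal (J ^ 2), ∀ y ∈ J ^ 2, x * y = 0 := by
    intro x hx y hy
    rw [LinearMap.BilinForm.mem_orthogonal_iff] at hx
    apply g.nd
    intro b
    have := hx _ (g.pow_mr (by norm_num) b y hy)
    rw [frm_apply] at this
    rw [g.symm, mul_assoc, g.symm, this]
  refine ⟨?_, hann⟩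
  intro x hx
  have h1 : x ∈ (1 : Submodule k A) ⊔ R :=
    g.orth_com (LinearMap.BilinForm.orthogonal_le g.com_le hx)
  obtain ⟨c', hc', r, hr, rfl⟩ := Submodule.mem_sup.1 h1
  obtain ⟨c, rfl⟩ := Submodule.mem_one.1 hc'
  by_cases hc : c = 0
  · simpa [hc] using hr
  exfalso
  -- then J ^ 2 = r J ^ 2
  have h2 : ∀ m, J ^ 2 ≤ J ^ (m + 2) := by
    intro m
    induction m with
    | zero => exact le_rfl
    | succ m ih =>
      intro y hy
      have h3 := hann _ hx y hy
      have h4 : y = c⁻¹ • (- r * y) := by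
        rw [add_mul, ← Algebra.smul_def] at h3
        rw [neg_mul, ← eq_neg_of_add_eq_zero_left h3, inv_smul_smul₀ hc]
      rw [h4, show m + 1 + 2 = (m + 2) + 1 by ring, pow_succ']
      exact Submodule.smul_mem _ _ (Submodule.mul_mem_mul (neg_mem (g.RJ hr)) (ih hy))
  obtain ⟨n, hn⟩ := g.nil
  have := h2 n
  rw [pow_add, hn, Submodule.bot_mul] at this
  exact h (le_bot_iff.1 this)

/-- A generated by one element and a central one is commutative -/
theorem not_two_gen (g : Good J R s) (x z : A) (hz : ∀ a, z * a = a * z)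
    (h : J ≤ Submodule.span k {x, z} ⊔ J ^ 2) : False := by
  let C : Submodule k A := Subalgebra.toSubmodule (Subalgebra.centralizer k {x})
  have hVC : Submodule.span k {x, z} ≤ C := by
    rw [Submodule.span_le]
    rintro y (rfl | rfl)
    · simp [C, Set.mem_centralizer_iff]
    · simp [C, Set.mem_centralizer_iff, hz]
  have hC : ∀ m, J ≤ C ⊔ J ^ (m + 2) := by
    intro m
    induction m with
    | zero => exact h.trans (sup_le_sup_right hVC _)
    | succ m ih =>
      have h1 : J ≤ J ^ (m + 2) ⊔ C ⊓ J := by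
        rw [← sup_inf_assoc_of_le _ (g.pow_le_J (by omega))]
        exact le_inf (by rw [sup_comm]; exact ih) le_rfl
      have h2 : J ^ 2 ≤ C ⊔ J ^ (m + 1 + 2) := by
        rw [pow_two]
        refine (mul_le_mul' h1 le_rfl).trans ?_
        rw [Submodule.sup_mul]
        refine sup_le (le_sup_of_le_right ?_) ?_
        · rw [show m + 1 + 2 = (m + 2) + 1 by ring, pow_succ (n := m + 2)]
        · refine (mul_le_mul' le_rfl h1).trans ?_
          rw [Submodule.mul_sup]
          refine sup_le (le_sup_of_le_right ?_) (le_sup_of_le_left ?_)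
          · rw [show m + 1 + 2 = (m + 2) + 1 by ring, pow_succ' (n := m + 2)]
            exact mul_le_mul' inf_le_right le_rfl
          · rw [Submodule.mul_le]
            intro a ha b hb
            exact (Subalgebra.centralizer k {x}).mul_mem ha.1 hb.1
      exact h.trans (sup_le (hVC.trans le_sup_left) h2)
  obtain ⟨n, hn⟩ := g.nil
  have hJC : J ≤ C := by
    have := hC n
    rwa [pow_add, hn, Submodule.bot_mul, sup_bot_eq] at this
  have hall : ∀ a : A, a ∈ Subalgebra.centralizer k {x} := by
    intro a
    obtain ⟨c, hc⟩ := g.top a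
    have h1 : a - algebraMap k A c ∈ Subalgebra.centralizer k {x} := hJC hc
    have := add_mem h1 ((Subalgebra.centralizer k {x}).algebraMap_mem c)
    simpa using this
  have hx : ∀ a, x * a = a * x := by
    intro a
    have := hall a
    rw [Subalgebra.mem_centralizer_iff] at this
    exact this x rfl
  -- now all generators are central
  have hVR : ∀ y ∈ Submodule.span k {x, z}, ∀ a, y * a = a * y := by
    intro y hy a
    obtain ⟨c, d, rfl⟩ := Submodule.mem_span_pair.1 hy
    simp [add_mul, mul_add, hx a, hz a]
  have hCC : ∀ m, J ≤ Subalgebra.toSubmodule (Subalgebra.center k A) ⊔ J ^ (m + 2) := by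
    intro m
    have hVC' : Submodule.span k {x, z} ≤ Subalgebra.toSubmodule (Subalgebra.center k A) := by
      intro y hy
      rw [Subalgebra.mem_toSubmodule, Subalgebra.mem_center_iff]
      intro b
      exact (hVR y hy b).symm
    induction m with
    | zero => exact h.trans (sup_le_sup_right hVC' _)
    | succ m ih =>
      have h1 : J ≤ J ^ (m + 2) ⊔ Subalgebra.toSubmodule (Subalgebra.center k A) ⊓ J := by
        rw [← sup_inf_assoc_of_le _ (g.pow_le_J (by omega))]
        exact le_inf (by rw [sup_comm]; exact ih) le_rfl
      have h2 : J ^ 2 ≤ Subalgebra.toSubmodule (Subalgebra.center k A) ⊔ J ^ (m + 1 + 2) := by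
        rw [pow_two]
        refine (mul_le_mul' h1 le_rfl).trans ?_
        rw [Submodule.sup_mul]
        refine sup_le (le_sup_of_le_right ?_) ?_
        · rw [show m + 1 + 2 = (m + 2) + 1 by ring, pow_succ (n := m + 2)]
        · refine (mul_le_mul' le_rfl h1).trans ?_
          rw [Submodule.mul_sup]
          refine sup_le (le_sup_of_le_right ?_) (le_sup_of_le_left ?_)
          · rw [show m + 1 + 2 = (m + 2) + 1 by ring, pow_succ' (n := m + 2)]
            exact mul_le_mul' inf_le_right le_rfl
          · rw [Submodule.mul_le]
            intro a ha b hb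
            exact (Subalgebra.center k A).mul_mem ha.1 hb.1
      exact h.trans (sup_le (hVC'.trans le_sup_left) h2)
  have hJR : J ≤ R := by
    have := hCC n
    rw [pow_add, hn, Submodule.bot_mul, sup_bot_eq] at this
    intro y hy
    apply g.Rmax y hy
    intro a
    have h5 := this hy
    rw [Subalgebra.mem_toSubmodule, Subalgebra.mem_center_iff] at h5
    exact (h5 a).symm
  have := Submodule.finrank_mono hJR
  rw [g.dimJ, g.dimR] at this
  omega

/-- The bound on `dim J ^ 3`. -/
theorem dim3 (g : Good J R s) (h3 : J ^ 3 ≠ ⊥) (h : 6 ≤ finrank k ↥(R ⊔ J ^ 2)) :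
    3 ≤ finrank k ↥(J ^ 3) := by
  have hU : R ⊔ J ^ 2 ≤ J := sup_le g.RJ (g.pow_le_J (by norm_num))
  obtain ⟨x, y, hx, hy, hxy⟩ : ∃ x y, x ∈ J ∧ y ∈ J ∧
      J ≤ R ⊔ J ^ 2 ⊔ Submodule.span k {x} ⊔ Submodule.span k {y} := by
    by_cases h7 : 7 ≤ finrank k ↥(R ⊔ J ^ 2)
    · obtain ⟨x, hx, hx'⟩ := exists_gen _ _ hU (by rw [g.dimJ]; omega)
      exact ⟨x, 0, hx, J.zero_mem, hx'.trans le_sup_left⟩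
    · obtain ⟨x, hx, hxU⟩ : ∃ x ∈ J, x ∉ R ⊔ J ^ 2 := by
        by_contra hcon
        push Not at hcon
        have := Submodule.finrank_mono (show J ≤ R ⊔ J ^ 2 from hcon)
        rw [g.dimJ] at this
        omega
      have hlt : R ⊔ J ^ 2 < R ⊔ J ^ 2 ⊔ Submodule.span k {x} := by
        refine lt_of_le_of_ne le_sup_left ?_
        intro he
        apply hxU
        rw [he]
        exact Submodule.mem_sup_right (Submodule.mem_span_singleton_self x)
      have hle : R ⊔ J ^ 2 ⊔ Submodule.span k {x} ≤ J :=
        sup_le hU ((Submodule.span_singleton_le_iff_mem x J).2 hx)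
      have := Submodule.finrank_lt_finrank_of_lt hlt
      obtain ⟨y, hy, hy'⟩ := exists_gen _ _ hle (by rw [g.dimJ]; omega)
      exact ⟨x, y, hx, hy, hy'⟩
  have hdec : ∀ a : A, ∃ (z p : A) (c d : k), (∀ b, z * b = b * z) ∧ p ∈ J ^ 2 ∧ a = z + p + c • x + d • y := by
    intro a
    obtain ⟨e, he⟩ := g.top a
    obtain ⟨u, hu, w, hw, huw⟩ := Submodule.mem_sup.1 (hxy he)
    obtain ⟨u', hu', w', hw', rfl⟩ := Submodule.mem_sup.1 hu
    obtain ⟨r, hr, p, hp, rfl⟩ := Submodule.mem_sup.1 hu'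
    obtain ⟨c, rfl⟩ := Submodule.mem_span_singleton.1 hw'
    obtain ⟨d, rfl⟩ := Submodule.mem_span_singleton.1 hw
    refine ⟨algebraMap k A e + r, p, c, d, ?_, hp, ?_⟩
    · intro b
      rw [add_mul, mul_add, g.Rc r hr, Algebra.commutes]
    · rw [eq_sub_iff_add_eq] at huw
      rw [← huw]
      abel
  have hK : comSp k A ≤ Submodule.span k {x * y - y * x} ⊔ J ^ 3 := by
    refine Submodule.span_le.2 ?_
    rintro _ ⟨a, b, rfl⟩
    obtain ⟨z, p, c, d, hz, hp, ha⟩ := hdec a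
    obtain ⟨z', p', c', d', hz', hp', hb⟩ := hdec b
    have h12 : ∀ u ∈ J, ∀ v ∈ J ^ 2, u * v ∈ J ^ 3 := by
      intro u hu v hv
      rw [pow_succ' J 2]
      exact Submodule.mul_mem_mul hu hv
    have h21 : ∀ u ∈ J ^ 2, ∀ v ∈ J, u * v ∈ J ^ 3 := by
      intro u hu v hv
      rw [pow_succ J 2]
      exact Submodule.mul_mem_mul hu hv
    have hab : a * b - b * a = (c * d' - d * c') • (x * y - y * x) +
        ((p * (p' + c' • x + d' • y) - (p' + c' • x + d' • y) * p) +
         ((c • x + d • y) * p' - p' * (c • x + d • y))) := by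
      have e1 : a * b - b * a = (p + c • x + d • y) * (p' + c' • x + d' • y)
          - (p' + c' • x + d' • y) * (p + c • x + d • y) := by
        have : a * b - b * a = (a - z) * (b - z') - (b - z') * (a - z) := by
          simp only [sub_mul, mul_sub, hz b, hz' a, hz z']
          abel
        rw [this, ha, hb]
        congr 2 <;> abel
      rw [e1]
      simp only [add_mul, mul_add, smul_mul_assoc, mul_smul_comm]
      module
    rw [hab]
    have hp1 := g.pow_le_J (by norm_num) hp
    have hp1' := g.pow_le_J (by norm_num) hp'
    have hl : c • x + d • y ∈ J := add_mem (J.smul_mem _ hx) (J.smul_mem _ hy)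
    have hl' : p' + c' • x + d' • y ∈ J :=
      add_mem (add_mem hp1' (J.smul_mem _ hx)) (J.smul_mem _ hy)
    refine add_mem (Submodule.mem_sup_left ?_) (Submodule.mem_sup_right ?_)
    · exact Submodule.smul_mem _ _ (Submodule.mem_span_singleton_self _)
    · exact add_mem (sub_mem (h21 _ hp _ hl') (h12 _ hl' _ hp))
        (sub_mem (h12 _ hl _ hp') (h21 _ hp' _ hl))
  have h4 := g.dim_com_soc (by norm_num) h3
  have h5 : comSp k A ⊔ socJ J ≤ Submodule.span k {x * y - y * x} ⊔ J ^ 3 :=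
    sup_le hK ((g.soc_le (by norm_num) h3).trans le_sup_right)
  have h6 := Submodule.finrank_mono h5
  have h7 := Submodule.finrank_add_le_finrank_add_finrank (Submodule.span k {x * y - y * x}) (J ^ 3)
  have h8 : finrank k (Submodule.span k {x * y - y * x}) ≤ 1 :=
    (finrank_span_le_card _).trans (by simp)
  omega

end Good
end Abstract

section Abstract2

set_option linter.unusedSectionVars false
set_option linter.unusedVariables false

open Polynomial

variable {k A : Type} [Field k] [Ring A] [Algebra k A] [FiniteDimensional k A]
variable {J R : Submodule k A} {s : A →ₗ[k] k}

namespace Good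

theorem exists_pow (g : Good J R s) {i : ℕ} (hi : 1 ≤ i)
    (h : finrank k ↥(J ^ i) = finrank k ↥(J ^ (i + 1)) + 1) (h0 : J ^ (i + 1) ≠ ⊥) :
    ∃ a ∈ J, a ^ i ∉ J ^ (i + 1) := by
  obtain ⟨m, hm, hspan⟩ := exists_gen (J ^ (i + 1)) (J ^ i) (g.pow_anti hi (by omega)) (by omega)
  have hm' : m ∉ J ^ (i + 1) := by
    intro hmem
    have : J ^ i ≤ J ^ (i + 1) :=
      hspan.trans (sup_le le_rfl ((Submodule.span_singleton_le_iff_mem _ _).2 hmem))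
    have := Submodule.finrank_mono this
    omega
  obtain ⟨φ, hφm, hφ⟩ := Submodule.exists_le_ker_of_notMem hm'
  obtain ⟨v, hv, hv'⟩ := Set.exists_of_ssubset (g.pow_lt (by omega) h0)
  obtain ⟨ψ, hψv, hψ⟩ := Submodule.exists_le_ker_of_notMem hv'
  have hdec : ∀ y ∈ J ^ i, ∃ w ∈ J ^ (i + 1), ∃ c : k, y = w + c • m ∧ φ y = c * φ m := by
    intro y hy
    obtain ⟨w, hw, u, hu, rfl⟩ := Submodule.mem_sup.1 (hspan hy)
    obtain ⟨c, rfl⟩ := Submodule.mem_span_singleton.1 hu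
    refine ⟨w, hw, c, rfl, ?_⟩
    have : φ w = 0 := hφ hw
    simp [this]
  have hL : ∀ x ∈ J, ∀ y ∈ J ^ i, ψ (x * y) * φ m = φ y * ψ (x * m) := by
    intro x hx y hy
    obtain ⟨w, hw, c, rfl, hc⟩ := hdec y hy
    have : x * w ∈ J ^ (i + 1 + 1) := by
      rw [pow_succ' J (i + 1)]; exact Submodule.mul_mem_mul hx hw
    have h2 : ψ (x * w) = 0 := hψ this
    rw [hc, mul_add, map_add, h2, mul_smul_comm, map_smul, smul_eq_mul]
    ring
  have hR : ∀ x ∈ J, ∀ y ∈ J ^ i, ψ (y * x) * φ m = φ y * ψ (m * x) := by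
    intro x hx y hy
    obtain ⟨w, hw, c, rfl, hc⟩ := hdec y hy
    have : w * x ∈ J ^ (i + 1 + 1) := by
      rw [pow_succ J (i + 1)]; exact Submodule.mul_mem_mul hw hx
    have h2 : ψ (w * x) = 0 := hψ this
    rw [hc, add_mul, map_add, h2, smul_mul_assoc, map_smul, smul_eq_mul]
    ring
  obtain ⟨a, ha, hψa⟩ : ∃ a ∈ J, ψ (a * m) ≠ 0 := by
    by_contra hcon
    push Not at hcon
    apply hψv
    have : J ^ (i + 1) ≤ LinearMap.ker ψ := by
      rw [pow_succ', Submodule.mul_le]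
      intro x hx y hy
      have := hL x hx y hy
      rw [hcon x hx, mul_zero] at this
      exact (mul_eq_zero.1 this).resolve_right hφm
    exact this hv
  refine ⟨a, ha, ?_⟩
  have claim : ∀ j, j ≤ i → ∃ y ∈ J ^ (i - j), φ (a ^ j * y) ≠ 0 := by
    intro j
    induction j with
    | zero => exact fun _ => ⟨m, hm, by simpa using hφm⟩
    | succ j ih =>
      intro hj
      obtain ⟨y, hy, hy0⟩ := ih (by omega)
      by_contra hcon
      push Not at hcon
      have e : i - j = (i - (j + 1)) + 1 := by omega
      have hmem : ∀ l, ∀ y ∈ J ^ l, a ^ (i - l) * y ∈ J ^ (i - l + l) := by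
        intro l y hy
        rw [pow_add]
        exact Submodule.mul_mem_mul (Submodule.pow_mem_pow J ha _) hy
      have h1 : ∀ y ∈ J ^ (i - j), ψ (a ^ (j + 1) * y) = 0 := by
        intro y hy
        rw [e, pow_succ] at hy
        refine Submodule.mul_induction_on hy ?_ ?_
        · intro y' hy' x hx
          have hyy : a ^ (j + 1) * y' ∈ J ^ i := by
            have := hmem _ y' hy'
            rwa [show i - (i - (j + 1)) = j + 1 by omega,
              show j + 1 + (i - (j + 1)) = i by omega] at this
          have := hR x hx _ hyy
          rw [hcon y' hy', zero_mul, mul_assoc] at this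
          exact (mul_eq_zero.1 this).resolve_right hφm
        · intro x y hx hy
          rw [mul_add, map_add, hx, hy, add_zero]
      have hyy : a ^ j * y ∈ J ^ i := by
        have := hmem _ y hy
        rwa [show i - (i - j) = j by omega, show j + (i - j) = i by omega] at this
      have h2 := hL a ha _ hyy
      rw [← mul_assoc, ← pow_succ', h1 y hy, zero_mul] at h2
      exact mul_ne_zero hy0 hψa h2.symm
  obtain ⟨y, hy, hy0⟩ := claim i le_rfl
  rw [Nat.sub_self, pow_zero] at hy
  obtain ⟨c, rfl⟩ := Submodule.mem_one.1 hy
  intro hmem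
  apply hy0
  rw [← Algebra.commutes, ← Algebra.smul_def, map_smul]
  have : φ (a ^ i) = 0 := hφ hmem
  rw [this, smul_zero]

theorem exists_poly (g : Good J R s) {i : ℕ} (hi : 1 ≤ i)
    (h : finrank k ↥(J ^ i) = finrank k ↥(J ^ (i + 1)) + 1) (h0 : J ^ (i + 1) ≠ ⊥) :
    ∃ a ∈ J, ∀ y ∈ J ^ i, ∃ q : k[X], y = a ^ i * aeval a q := by
  obtain ⟨a, ha, hai⟩ := g.exists_pow hi h h0
  refine ⟨a, ha, ?_⟩
  have hle : J ^ (i + 1) ≤ J ^ i := g.pow_anti hi (by omega)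
  have hstep : ∀ j, i ≤ j → ∀ y ∈ J ^ j, ∃ c : k, y - c • a ^ j ∈ J ^ (j + 1) := by
    intro j hj
    induction j, hj using Nat.le_induction with
    | base =>
      intro y hy
      have h1 : J ^ (i + 1) ⊔ Submodule.span k {a ^ i} ≤ J ^ i :=
        sup_le hle ((Submodule.span_singleton_le_iff_mem _ _).2 (Submodule.pow_mem_pow J ha _))
      have h2 : J ^ (i + 1) < J ^ (i + 1) ⊔ Submodule.span k {a ^ i} := by
        refine lt_of_le_of_ne le_sup_left fun he => hai ?_
        rw [he]
        exact Submodule.mem_sup_right (Submodule.mem_span_singleton_self _)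
      have h3 := Submodule.finrank_lt_finrank_of_lt h2
      have h4 := Submodule.eq_of_le_of_finrank_le h1 (by omega)
      rw [← h4] at hy
      obtain ⟨w, hw, u, hu, rfl⟩ := Submodule.mem_sup.1 hy
      obtain ⟨c, rfl⟩ := Submodule.mem_span_singleton.1 hu
      exact ⟨c, by simpa using hw⟩
    | succ j hj ih =>
      intro y hy
      rw [pow_succ' J j] at hy
      refine Submodule.mul_induction_on hy ?_ ?_
      · intro x hx y hy
        obtain ⟨c, hc⟩ := ih y hy
        obtain ⟨j, rfl⟩ : ∃ j', j = j' + 1 := ⟨j - 1, by omega⟩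
        have h1 : x * a ^ j ∈ J ^ (j + 1) := by
          rw [pow_succ']
          exact Submodule.mul_mem_mul hx (Submodule.pow_mem_pow J ha _)
        obtain ⟨d, hd⟩ := ih _ h1
        refine ⟨c * d, ?_⟩
        have e : x * y - (c * d) • a ^ (j + 1 + 1) =
            x * (y - c • a ^ (j + 1)) + c • ((x * a ^ j - d • a ^ (j + 1)) * a) := by
          rw [mul_sub, sub_mul, smul_sub, mul_smul_comm, smul_mul_assoc, mul_assoc x, ← pow_succ,
            ← pow_succ, smul_smul]
          abel
        rw [e]
        refine add_mem ?_ (Submodule.smul_mem _ _ ?_)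
        · rw [pow_succ' J (j + 1 + 1)]
          exact Submodule.mul_mem_mul hx hc
        · rw [pow_succ J (j + 1 + 1)]
          exact Submodule.mul_mem_mul hd ha
      · rintro x y ⟨c, hc⟩ ⟨d, hd⟩
        refine ⟨c + d, ?_⟩
        have := add_mem hc hd
        rw [add_smul]
        convert this using 1
        abel
  have hall : ∀ r, ∀ y ∈ J ^ i, ∃ q : k[X], y - a ^ i * aeval a q ∈ J ^ (i + r) := by
    intro r
    induction r with
    | zero => exact fun y hy => ⟨0, by simpa using hy⟩
    | succ r ih =>
      intro y hy
      obtain ⟨q, hq⟩ := ih y hy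
      obtain ⟨c, hc⟩ := hstep (i + r) (by omega) _ hq
      refine ⟨q + C c * X ^ r, ?_⟩
      have e : y - a ^ i * aeval a (q + C c * X ^ r) = y - a ^ i * aeval a q - c • a ^ (i + r) := by
        simp only [map_add, map_mul, aeval_C, aeval_X, map_pow, mul_add, ← Algebra.smul_def,
          mul_smul_comm, pow_add]
        abel
      rw [e]
      exact hc
  intro y hy
  obtain ⟨n, hn⟩ := g.nil
  obtain ⟨q, hq⟩ := hall n y hy
  rw [pow_add, hn, Submodule.mul_bot, Submodule.mem_bot, sub_eq_zero] at hq
  exact ⟨q, hq⟩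

/-- polynomials in `a` without constant term -/
def Pa (k : Type) {A : Type} [Field k] [Ring A] [Algebra k A] (a : A) : Submodule k A :=
  LinearMap.range ((LinearMap.mulLeft k a).comp (aeval a : k[X] →ₐ[k] A).toLinearMap)

theorem mem_Pa {a x : A} : x ∈ Pa k a ↔ ∃ q : k[X], a * aeval a q = x := by
  simp [Pa]

/-- the annihilator of `a ^ n` in `J` -/
def Na (J : Submodule k A) (a : A) (n : ℕ) : Submodule k A :=
  J ⊓ LinearMap.ker (LinearMap.mulLeft k (a ^ n))

theorem mem_Na {a x : A} {n : ℕ} : x ∈ Na J a n ↔ x ∈ J ∧ a ^ n * x = 0 := by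
  simp [Na]

theorem Na_le {a : A} {n : ℕ} : Na J a n ≤ J := inf_le_left

theorem Pa_le (g : Good J R s) {a : A} (ha : a ∈ J) : Pa k a ≤ J := by
  intro x hx
  obtain ⟨q, rfl⟩ := mem_Pa.1 hx
  exact g.mr _ _ ha

theorem mem_Pa_pow {a : A} (m : ℕ) : ∀ x ∈ Pa k a ^ m, ∃ q : k[X], x = a ^ m * aeval a q := by
  induction m with
  | zero =>
    intro x hx
    rw [pow_zero] at hx
    obtain ⟨c, rfl⟩ := Submodule.mem_one.1 hx
    exact ⟨C c, by simp⟩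
  | succ m ih =>
    intro x hx
    rw [pow_succ] at hx
    refine Submodule.mul_induction_on hx ?_ ?_
    · intro u hu v hv
      obtain ⟨q, rfl⟩ := ih u hu
      obtain ⟨r, rfl⟩ := mem_Pa.1 hv
      refine ⟨q * r, ?_⟩
      have := congrArg (aeval a) (show X ^ m * q * (X * r) = X ^ (m + 1) * (q * r) by ring)
      simpa only [map_mul, map_pow, aeval_X] using this
    · rintro x y ⟨q, rfl⟩ ⟨r, rfl⟩
      exact ⟨q + r, by rw [map_add, mul_add]⟩

theorem mem_Pa_self {a : A} : a ∈ Pa k a := mem_Pa.2 ⟨1, by simp⟩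

/-- main hypothesis: `J ^ (n+1)` consists of polynomials in `a`. -/
theorem le_PN (g : Good J R s) {a : A} {n : ℕ} (ha : a ∈ J)
    (hp : ∀ y ∈ J ^ (n + 1), ∃ q : k[X], y = a ^ (n + 1) * aeval a q) : J ≤ Pa k a ⊔ Na J a n := by
  intro x hx
  have h1 : a ^ n * x ∈ J ^ (n + 1) := by
    rw [pow_succ]
    exact Submodule.mul_mem_mul (Submodule.pow_mem_pow J ha _) hx
  obtain ⟨q, hq⟩ := hp _ h1
  have e : x = a * aeval a q + (x - a * aeval a q) := by abel
  rw [e]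
  refine add_mem (Submodule.mem_sup_left (mem_Pa.2 ⟨q, rfl⟩)) (Submodule.mem_sup_right ?_)
  rw [mem_Na]
  refine ⟨sub_mem hx (g.mr _ _ ha), ?_⟩
  rw [mul_sub, hq, pow_succ, mul_assoc, sub_self]

theorem mem_soc_of (g : Good J R s) {a : A} {n : ℕ} (ha : a ∈ J)
    (hp : ∀ y ∈ J ^ (n + 1), ∃ q : k[X], y = a ^ (n + 1) * aeval a q)
    (p : A) (hpJ : p ∈ J ^ (n + 1)) (h0 : a * p = 0) : p ∈ socJ J := by
  obtain ⟨q, rfl⟩ := hp p hpJ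
  intro x hx
  constructor
  · have h1 : x * a ^ n ∈ J ^ (n + 1) := by
      rw [pow_succ']
      exact Submodule.mul_mem_mul hx (Submodule.pow_mem_pow J ha _)
    obtain ⟨r, hr⟩ := hp _ h1
    have e := congrArg (aeval a)
      (show X ^ (n + 1) * r * (X * q) = r * (X * (X ^ (n + 1) * q)) by ring)
    simp only [map_mul, map_pow, aeval_X] at e
    rw [pow_succ, ← mul_assoc, ← mul_assoc, hr, mul_assoc (a ^ (n + 1) * aeval a r), e, h0, mul_zero]
  · have h1 : a ^ n * x ∈ J ^ (n + 1) := by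
      rw [pow_succ]
      exact Submodule.mul_mem_mul (Submodule.pow_mem_pow J ha _) hx
    obtain ⟨r, hr⟩ := hp _ h1
    have e := congrArg (aeval a)
      (show X * q * (X ^ (n + 1) * r) = r * (X * (X ^ (n + 1) * q)) by ring)
    have e2 := congrArg (aeval a)
      (show X ^ (n + 1) * q = (X * q) * X ^ n by ring)
    simp only [map_mul, map_pow, aeval_X] at e e2
    rw [e2, mul_assoc, hr, e, h0, mul_zero]

theorem PN_zero (g : Good J R s) {a : A} {n : ℕ} : Pa k a ^ n * Na J a n = ⊥ := by
  rw [eq_bot_iff, Submodule.mul_le]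
  intro x hx y hy
  obtain ⟨q, rfl⟩ := mem_Pa_pow n x hx
  have e := congrArg (aeval a) (show X ^ n * q = q * X ^ n by ring)
  simp only [map_mul, map_pow, aeval_X] at e
  rw [Submodule.mem_bot, e, mul_assoc, (mem_Na.1 hy).2, mul_zero]

theorem PNJ_soc (g : Good J R s) {a : A} {n : ℕ} (ha : a ∈ J)
    (hp : ∀ y ∈ J ^ (n + 1), ∃ q : k[X], y = a ^ (n + 1) * aeval a q) :
    ∀ m j, j + m = n → Pa k a ^ j * Na J a n * J ^ m ≤ socJ J := by
  intro m
  induction m with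
  | zero =>
    intro j hj
    obtain rfl : j = n := by omega
    rw [g.PN_zero, Submodule.bot_mul]
    exact bot_le
  | succ m ih =>
    intro j hj w hw
    apply g.mem_soc_of ha hp
    · have h1 : Pa k a ^ j * Na J a n * J ^ (m + 1) ≤ J ^ j * J * J ^ (m + 1) :=
        mul_le_mul' (mul_le_mul' (pow_le_pow_left' (g.Pa_le ha) j) Na_le) le_rfl
      have := h1 hw
      rwa [← pow_succ, ← pow_add, show j + 1 + (m + 1) = n + 1 by omega] at this
    · have h1 : a * w ∈ Pa k a * (Pa k a ^ j * Na J a n * J ^ (m + 1)) :=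
        Submodule.mul_mem_mul mem_Pa_self hw
      have h2 : Pa k a * (Pa k a ^ j * Na J a n * J ^ (m + 1)) =
          (Pa k a ^ (j + 1) * Na J a n * J ^ m) * J := by
        rw [pow_succ' (Pa k a), pow_succ J]
        simp only [mul_assoc]
      rw [h2] at h1
      have h3 : (Pa k a ^ (j + 1) * Na J a n * J ^ m) * J ≤ ⊥ := by
        rw [Submodule.mul_le]
        intro u hu v hv
        exact (ih (j + 1) (by omega) hu v hv).2
      exact h3 h1

theorem PNJ_zero (g : Good J R s) {a : A} {n : ℕ} (ha : a ∈ J)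
    (hp : ∀ y ∈ J ^ (n + 1), ∃ q : k[X], y = a ^ (n + 1) * aeval a q)
    (j l m : ℕ) (hm : j + l + m = n) (z w : A) (hz : z ∈ Pa k a ^ j * Na J a n * J ^ l)
    (hw : w ∈ J ^ (m + 1)) : z * w = 0 := by
  have h1 : z * w ∈ (Pa k a ^ j * Na J a n * J ^ l) * J ^ (m + 1) := Submodule.mul_mem_mul hz hw
  have h2 : (Pa k a ^ j * Na J a n * J ^ l) * J ^ (m + 1) =
      (Pa k a ^ j * Na J a n * J ^ (l + m)) * J := by
    rw [pow_succ J, pow_add]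
    simp only [mul_assoc]
  have h3 : (Pa k a ^ j * Na J a n * J ^ (l + m)) * J ≤ ⊥ := by
    rw [Submodule.mul_le]
    intro u hu v hv
    exact (g.PNJ_soc ha hp (l + m) j (by omega) hu v hv).2
  rw [h2] at h1
  exact h3 h1

theorem decomp (g : Good J R s) {a : A} {n : ℕ} (ha : a ∈ J)
    (hp : ∀ y ∈ J ^ (n + 1), ∃ q : k[X], y = a ^ (n + 1) * aeval a q)
    (M : ℕ) (T : Submodule k A) (h1 : Pa k a ^ M ≤ T)
    (h2 : ∀ j l, j + l + 1 = M → Pa k a ^ j * Na J a n * J ^ l ≤ T) : J ^ M ≤ T := by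
  have : ∀ m j, j + m = M → Pa k a ^ j * J ^ m ≤ T := by
    intro m
    induction m with
    | zero =>
      intro j hj
      obtain rfl : j = M := by omega
      simpa using h1
    | succ m ih =>
      intro j hj
      have h3 : Pa k a ^ j * J ^ (m + 1) ≤ Pa k a ^ j * ((Pa k a ⊔ Na J a n) * J ^ m) := by
        rw [pow_succ' J]
        exact mul_le_mul' le_rfl (mul_le_mul' (g.le_PN ha hp) le_rfl)
      refine h3.trans ?_
      rw [Submodule.sup_mul, Submodule.mul_sup, ← mul_assoc, ← mul_assoc, ← pow_succ]
      exact sup_le (ih (j + 1) (by omega)) (h2 j m (by omega))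
  simpa using this M 0 (by omega)

theorem pow_le_R (g : Good J R s) {a : A} {n : ℕ} (hn : 1 ≤ n) (ha : a ∈ J)
    (hp : ∀ y ∈ J ^ (n + 1), ∃ q : k[X], y = a ^ (n + 1) * aeval a q) : J ^ n ≤ R := by
  have hsub : ∀ x y : A, x * y ∈ socJ J → y * x ∈ socJ J → x * y = y * x := by
    intro x y h1 h2
    rw [← sub_eq_zero]
    exact g.com_soc _ (com_mem x y) (sub_mem h1 h2)
  have hNJ : ∀ x ∈ Na J a n, ∀ y ∈ J ^ n, x * y ∈ socJ J := by
    intro x hx y hy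
    have := g.PNJ_soc ha hp n 0 (by omega)
    rw [pow_zero, one_mul] at this
    exact this (Submodule.mul_mem_mul hx hy)
  have hT : J ^ n ≤ Subalgebra.toSubmodule (Subalgebra.centralizer k (J : Set A)) := by
    have hmemT : ∀ y : A, (∀ x ∈ Pa k a, x * y = y * x) → (∀ x ∈ Na J a n, x * y = y * x) →
        y ∈ Subalgebra.toSubmodule (Subalgebra.centralizer k (J : Set A)) := by
      intro y h1 h2
      rw [Subalgebra.mem_toSubmodule, Subalgebra.mem_centralizer_iff]
      intro x hx
      obtain ⟨u, hu, v, hv, rfl⟩ := Submodule.mem_sup.1 (g.le_PN ha hp hx)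
      rw [add_mul, mul_add, h1 u hu, h2 v hv]
    apply g.decomp ha hp
    · intro y hy
      have hyJ : y ∈ J ^ n := pow_le_pow_left' (g.Pa_le ha) n hy
      apply hmemT
      · intro x hx
        obtain ⟨q, rfl⟩ := mem_Pa_pow n y hy
        obtain ⟨r, rfl⟩ := mem_Pa.1 hx
        have := congrArg (aeval a) (show X * r * (X ^ n * q) = X ^ n * q * (X * r) by ring)
        simpa only [map_mul, map_pow, aeval_X] using this
      · intro x hx
        apply hsub _ _ (hNJ x hx y hyJ)
        have : y * x ∈ Pa k a ^ n * Na J a n := Submodule.mul_mem_mul hy hx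
        rw [g.PN_zero, Submodule.mem_bot] at this
        rw [this]
        exact zero_mem _
    · intro j l hjl y hy
      have hyJ : y ∈ J ^ n := by
        have h1 : Pa k a ^ j * Na J a n * J ^ l ≤ J ^ j * J * J ^ l :=
          mul_le_mul' (mul_le_mul' (pow_le_pow_left' (g.Pa_le ha) j) Na_le) le_rfl
        have := h1 hy
        rwa [← pow_succ, ← pow_add, show j + 1 + l = n by omega] at this
      have hyx : ∀ x ∈ J, y * x ∈ socJ J := by
        intro x hx
        have h1 := g.PNJ_soc ha hp (l + 1) j (by omega)
        apply h1
        rw [pow_succ J, ← mul_assoc]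
        exact Submodule.mul_mem_mul hy hx
      apply hmemT
      · intro x hx
        apply hsub _ _ _ (hyx x (g.Pa_le ha hx))
        have h1 := g.PNJ_soc ha hp l (j + 1) (by omega)
        apply h1
        rw [pow_succ', mul_assoc, mul_assoc, ← mul_assoc (_ ^ j)]
        exact Submodule.mul_mem_mul hx hy
      · intro x hx
        exact hsub _ _ (hNJ x hx y hyJ) (hyx x (Na_le hx))
  intro y hy
  apply g.Rmax y (g.pow_le_J hn hy)
  intro b
  obtain ⟨c, hc⟩ := g.top b
  have h1 := hT hy
  rw [Subalgebra.mem_toSubmodule, Subalgebra.mem_centralizer_iff] at h1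
  have h2 := h1 _ hc
  rw [sub_mul, mul_sub, Algebra.commutes c y] at h2
  exact (sub_left_injective h2).symm

end Good
end Abstract2

section Abstract3

set_option linter.unusedSectionVars false
set_option linter.unusedVariables false

open Polynomial

variable {k A : Type} [Field k] [Ring A] [Algebra k A] [FiniteDimensional k A]
variable {J R : Submodule k A} {s : A →ₗ[k] k}

/-- elements of `J ^ 2` killing `J ^ n` -/
def Ek (J : Submodule k A) (n : ℕ) : Submodule k A where
  carrier := {x | x ∈ J ^ 2 ∧ ∀ y ∈ J ^ n, x * y = 0}
  add_mem' := by
    rintro a b ⟨ha, ha'⟩ ⟨hb, hb'⟩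
    refine ⟨add_mem ha hb, fun y hy => ?_⟩
    simp [add_mul, ha' y hy, hb' y hy]
  zero_mem' := ⟨zero_mem _, fun y hy => zero_mul y⟩
  smul_mem' := by
    rintro c a ⟨ha, ha'⟩
    refine ⟨Submodule.smul_mem _ c ha, fun y hy => ?_⟩
    simp [ha' y hy]

namespace Good

theorem T2 (g : Good J R s) (h : finrank k ↥(J ^ 2) = finrank k ↥(J ^ 3) + 1) (h3 : J ^ 3 ≠ ⊥) :
    False := by
  obtain ⟨a, ha, hp⟩ := g.exists_poly (i := 2) (by norm_num) h h3
  have h1 := g.pow_le_R (n := 1) le_rfl ha hp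
  rw [pow_one] at h1
  have := Submodule.finrank_mono h1
  rw [g.dimJ, g.dimR] at this
  omega

theorem sq_decomp (g : Good J R s) {a : A} {n : ℕ} (hn : 2 ≤ n) (ha : a ∈ J)
    (hp : ∀ y ∈ J ^ (n + 1), ∃ q : k[X], y = a ^ (n + 1) * aeval a q)
    (h3 : ∀ w ∈ J ^ n, a ^ 3 * w = 0) : J ^ 2 ≤ Submodule.span k {a ^ 2} ⊔ Ek J n := by
  have ha2 : a ^ 2 ∈ J ^ 2 := Submodule.pow_mem_pow J ha 2
  have ha3 : a ^ 3 ∈ J ^ 2 := g.pow_anti (by norm_num) (by norm_num)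
    (Submodule.pow_mem_pow J ha 3)
  apply g.decomp ha hp
  · intro y hy
    obtain ⟨q, rfl⟩ := mem_Pa_pow 2 y hy
    have e : aeval a q = algebraMap k A (q.coeff 0) + a * aeval a q.divX := by
      conv_lhs => rw [← divX_mul_X_add q]
      have := congrArg (aeval a) (show q.divX * X + C (q.coeff 0) = C (q.coeff 0) + X * q.divX by
        ring)
      rw [this]
      simp
    have e2 : a ^ 2 * aeval a q = q.coeff 0 • a ^ 2 + a ^ 3 * aeval a q.divX := by
      rw [e, mul_add, ← mul_assoc, ← pow_succ, ← Algebra.commutes, ← Algebra.smul_def]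
    rw [e2]
    apply Submodule.add_mem_sup
    · exact Submodule.smul_mem _ _ (Submodule.mem_span_singleton_self _)
    · refine ⟨g.pow_mr (by norm_num) _ _ ha3, ?_⟩
      intro w hw
      rw [mul_assoc]
      exact h3 _ (g.pow_ml (by omega) _ _ hw)
  · intro j l hjl y hy
    apply Submodule.mem_sup_right
    refine ⟨?_, ?_⟩
    · have h1 : Pa k a ^ j * Na J a n * J ^ l ≤ J ^ j * J * J ^ l :=
        mul_le_mul' (mul_le_mul' (pow_le_pow_left' (g.Pa_le ha) j) Na_le) le_rfl
      have := h1 hy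
      rwa [← pow_succ, ← pow_add, show j + 1 + l = 2 by omega] at this
    · intro w hw
      exact g.PNJ_zero ha hp j l (n - 1) (by omega) y w hy
        (by rwa [show n - 1 + 1 = n by omega])

theorem pow_nil (g : Good J R s) {a : A} (ha : a ∈ J) : ∃ m, a ^ m = 0 := by
  obtain ⟨m, hm⟩ := g.nil
  refine ⟨m, ?_⟩
  have := Submodule.pow_mem_pow J ha m
  rwa [hm, Submodule.mem_bot] at this

theorem T3 (g : Good J R s) (h : finrank k ↥(J ^ 3) = finrank k ↥(J ^ 4) + 1) (h4 : J ^ 4 ≠ ⊥)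
    (h2 : 5 ≤ finrank k ↥(J ^ 2)) : False := by
  obtain ⟨a, ha, hp⟩ := g.exists_poly (i := 3) (by norm_num) h h4
  have hJR := g.pow_le_R (n := 2) (by norm_num) ha hp
  have hR : J ^ 2 = R := Submodule.eq_of_le_of_finrank_le hJR (by rw [g.dimR]; exact h2)
  have ha2 : a ^ 2 ∈ J ^ 2 := Submodule.pow_mem_pow J ha 2
  have ha3 : a ^ 3 ∈ J ^ 2 := g.pow_anti (by norm_num) (by norm_num)
    (Submodule.pow_mem_pow J ha 3)
  have ha5 : a ^ 5 = 0 := by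
    obtain ⟨t, ht⟩ := g.Rt
    obtain ⟨c, hc⟩ := ht _ (hJR ha2) _ (hJR ha2)
    obtain ⟨d, hd⟩ := ht _ (hJR ha2) _ (hJR ha3)
    rw [← pow_add] at hc hd
    norm_num at hc hd
    by_contra h5
    have hd0 : d ≠ 0 := by
      rintro rfl
      exact h5 (by rw [hd, zero_smul])
    have e : a ^ 4 = (c / d) • a ^ 5 := by
      rw [hd, hc, smul_smul, div_mul_cancel₀ _ hd0]
    have key : ∀ m, a ^ 4 = (c / d) ^ m • a ^ (4 + m) := by
      intro m
      induction m with
      | zero => simp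
      | succ m ih =>
        conv_lhs => rw [ih, pow_add, e]
        rw [smul_mul_assoc, smul_smul, ← pow_add, pow_succ]
        congr 2
        omega
    obtain ⟨m, hm⟩ := g.pow_nil ha
    have := key m
    rw [add_comm, pow_add, hm, zero_mul, smul_zero] at this
    exact h5 (by rw [pow_succ, this, zero_mul])
  have h3 : ∀ w ∈ J ^ 2, a ^ 3 * w = 0 := by
    have : J ^ 2 ≤ LinearMap.ker (LinearMap.mulLeft k (a ^ 3)) := by
      apply g.decomp ha hp
      · intro y hy
        obtain ⟨q, rfl⟩ := mem_Pa_pow 2 y hy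
        rw [LinearMap.mem_ker, LinearMap.mulLeft_apply, ← mul_assoc, ← pow_add, ha5, zero_mul]
      · intro j l hjl y hy
        have hy2 : y ∈ J ^ 2 := by
          have h1 : Pa k a ^ j * Na J a 2 * J ^ l ≤ J ^ j * J * J ^ l :=
            mul_le_mul' (mul_le_mul' (pow_le_pow_left' (g.Pa_le ha) j) Na_le) le_rfl
          have := h1 hy
          rwa [← pow_succ, ← pow_add, show j + 1 + l = 2 by omega] at this
        rw [LinearMap.mem_ker, LinearMap.mulLeft_apply, ← g.Rc y (hJR hy2)]
        exact g.PNJ_zero ha hp j l 1 (by omega) y _ hy ha3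
    intro w hw
    exact this hw
  have hd := g.sq_decomp le_rfl ha hp h3
  have h6 := Submodule.finrank_mono hd
  have h7 := Submodule.finrank_add_le_finrank_add_finrank (Submodule.span k {a ^ 2}) (Ek J 2)
  have h8 : finrank k (Submodule.span k {a ^ 2}) ≤ 1 := by
    simpa using finrank_span_le_card (R := k) ({a ^ 2} : Set A)
  have h9 : finrank k (Ek J 2) ≤ 3 := by
    apply g.Rann
    · intro x hx
      exact hJR hx.1
    · intro r hr r' hr'
      rw [← hR] at hr'
      exact hr.2 r' hr'
  omega

theorem T4 (g : Good J R s) (h2 : finrank k ↥(J ^ 2) = 6) (h3 : finrank k ↥(J ^ 3) = 4)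
    (h : finrank k ↥(J ^ 4) = finrank k ↥(J ^ 5) + 1) (h5 : J ^ 5 ≠ ⊥) (h6 : J ^ 6 = ⊥) :
    False := by
  obtain ⟨a, ha, hp⟩ := g.exists_poly (i := 4) (by norm_num) h h5
  have hJR := g.pow_le_R (n := 3) (by norm_num) ha hp
  have hz6 : ∀ x ∈ J ^ 6, x = 0 := by
    intro x hx
    rwa [h6, Submodule.mem_bot] at hx
  have ha3 : a ^ 3 ∈ J ^ 3 := Submodule.pow_mem_pow J ha 3
  have hRJ : R ≤ J ^ 2 := by
    intro z hz
    by_contra hz2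
    have h1 : J ^ 2 ⊔ Submodule.span k {z} ≤ J := sup_le (g.pow_le_J (by norm_num))
      ((Submodule.span_singleton_le_iff_mem _ _).2 (g.RJ hz))
    have h2' : J ^ 2 < J ^ 2 ⊔ Submodule.span k {z} := by
      refine lt_of_le_of_ne le_sup_left ?_
      intro h
      apply hz2
      rw [h]
      exact Submodule.mem_sup_right (Submodule.mem_span_singleton_self z)
    have h3' := Submodule.finrank_lt_finrank_of_lt h2'
    obtain ⟨x, hx, hxJ⟩ := exists_gen _ _ h1 (by rw [g.dimJ]; omega)
    apply g.not_two_gen x z (g.Rc z hz)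
    refine hxJ.trans (sup_le (sup_le le_sup_right ?_) ?_)
    · exact le_sup_of_le_left (Submodule.span_mono (by simp))
    · exact le_sup_of_le_left (Submodule.span_mono (by simp))
  obtain ⟨y, hy, z, hz, hyz⟩ : ∃ y ∈ J ^ 3, ∃ z ∈ R, y * z ≠ 0 := by
    by_contra hcon
    push Not at hcon
    have := g.Rann (J ^ 3) hJR hcon
    omega
  have hd := g.sq_decomp (by norm_num) ha hp (fun w hw => hz6 _ (by
    rw [show 6 = 3 + 3 from rfl, pow_add]
    exact Submodule.mul_mem_mul ha3 hw))
  obtain ⟨u, hu, n, hn, hun⟩ := Submodule.mem_sup.1 (hd (hRJ hz))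
  obtain ⟨c, rfl⟩ := Submodule.mem_span_singleton.1 hu
  have hzw : ∀ w ∈ J ^ 3, z * w = c • (a ^ 2 * w) := by
    intro w hw
    rw [← hun, add_mul, hn.2 w hw, add_zero, smul_mul_assoc]
  have hc : c ≠ 0 := by
    rintro rfl
    apply hyz
    rw [g.Rc y (hJR hy), hzw y hy, zero_smul]
  have hyz5 : y * z ∈ J ^ 5 := by
    rw [show 5 = 3 + 2 from rfl, pow_add]
    exact Submodule.mul_mem_mul hy (hRJ hz)
  have ha5 : a ^ 5 ≠ 0 := by
    intro h0
    apply h5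
    rw [eq_bot_iff, show 5 = 4 + 1 from rfl, pow_succ, Submodule.mul_le]
    intro u hu x hx
    obtain ⟨q, rfl⟩ := hp u hu
    have hx4 : a ^ 3 * x ∈ J ^ 4 := by
      rw [show 4 = 3 + 1 from rfl, pow_succ]
      exact Submodule.mul_mem_mul ha3 hx
    obtain ⟨r, hr⟩ := hp _ hx4
    have e := congrArg (aeval a) (show X ^ 4 * q = X * q * X ^ 3 by ring)
    simp only [map_mul, map_pow, aeval_X] at e
    have e2 := congrArg (aeval a) (show X * q * (X ^ 4 * r) = X ^ 5 * (q * r) by ring)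
    simp only [map_mul, map_pow, aeval_X] at e2
    rw [Submodule.mem_bot, e, mul_assoc, hr, e2, h0, zero_mul]
  have hzaJ : z * a ∈ J ^ 3 := by
    rw [show 3 = 2 + 1 from rfl, pow_succ]
    exact Submodule.mul_mem_mul (hRJ hz) ha
  have e1 : z * (z * a) = (c * c) • a ^ 5 := by
    rw [hzw _ hzaJ, ← mul_assoc, ← g.Rc z hz, mul_assoc, ← pow_succ, hzw _ ha3, smul_smul,
      ← pow_add]
  obtain ⟨t, ht⟩ := g.Rt
  obtain ⟨d, hd'⟩ := ht y (hJR hy) z hz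
  obtain ⟨f, hf⟩ := ht z hz z hz
  have hd0 : d ≠ 0 := by
    rintro rfl
    exact hyz (by rw [hd', zero_smul])
  have e2 : z * z = (f / d) • (y * z) := by
    rw [hd', hf, smul_smul, div_mul_cancel₀ _ hd0]
  have e3 : z * (z * a) = 0 := by
    rw [← mul_assoc, e2, smul_mul_assoc, hz6 (y * z * a), smul_zero]
    rw [show 6 = 5 + 1 from rfl, pow_succ]
    exact Submodule.mul_mem_mul hyz5 ha
  rw [e1] at e3
  rcases smul_eq_zero.1 e3 with h | h
  · exact hc (mul_self_eq_zero.1 h)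
  · exact ha5 h

theorem bot_of (g : Good J R s) {m : ℕ} (h : finrank k ↥(J ^ m) = 0) : J ^ m = ⊥ :=
  Submodule.finrank_eq_zero.1 h

theorem main (g : Good J R s) :
    (finrank k ↥(J ^ 2) = 5 ∨ finrank k ↥(J ^ 2) = 6) ∧ finrank k ↥(J ^ 3) = 3 ∧
      finrank k ↥(J ^ 4) = 1 := by
  have d1 : finrank k ↥(J ^ 1) = 8 := by rw [pow_one, g.dimJ]
  have l1 : finrank k ↥(J ^ 2) < finrank k ↥(J ^ 1) := g.dim_lt (m := 1) le_rfl (by omega)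
  have low : ∀ m, J ^ (m + 1) = ⊥ → finrank k ↥(J ^ m) ≤ 1 := fun m hm =>
    (Submodule.finrank_mono (g.le_soc hm)).trans g.dim_soc
  have b2 : J ^ 2 ≠ ⊥ := by
    intro h
    have := low 1 h
    omega
  have n7 : finrank k ↥(J ^ 2) ≠ 7 := by
    intro h
    obtain ⟨x, hx, hxJ⟩ := exists_gen (J ^ 2) J (g.pow_le_J (by norm_num)) (by rw [g.dimJ, h])
    apply g.not_two_gen x 0 (by simp)
    refine hxJ.trans (sup_le le_sup_right ?_)
    exact le_sup_of_le_left (Submodule.span_mono (by simp))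
  obtain ⟨hO, hO2⟩ := g.soc2 b2
  have fo := LinearMap.BilinForm.finrank_orthogonal g.frm_nd (J ^ 2)
  have fo2 := Submodule.finrank_mono hO
  rw [g.dimA] at fo
  rw [g.dimR] at fo2
  have b3 : J ^ 3 ≠ ⊥ := by
    intro h
    have := low 2 h
    omega
  have d3 : finrank k ↥(J ^ 3) ≠ 0 := fun h => b3 (g.bot_of h)
  have l2 : finrank k ↥(J ^ 3) < finrank k ↥(J ^ 2) := g.dim_lt (m := 2) (by norm_num) (by omega)
  have l3 : finrank k ↥(J ^ 4) < finrank k ↥(J ^ 3) := g.dim_lt (m := 3) (by norm_num) d3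
  have t2 : finrank k ↥(J ^ 2) ≠ finrank k ↥(J ^ 3) + 1 := fun h => g.T2 h b3
  have n4 : finrank k ↥(J ^ 2) ≠ 4 := by
    intro h
    have e : (frm s).orthogonal (J ^ 2) = R :=
      Submodule.eq_of_le_of_finrank_le hO (by rw [g.dimR]; omega)
    have h1 : finrank k ↥(R ⊓ J ^ 2) ≤ 3 := by
      apply g.Rann _ inf_le_left
      intro r hr r' hr'
      rw [g.Rc r hr.1]
      exact hO2 r' (e ▸ hr') r hr.2
    have h2 := Submodule.finrank_sup_add_finrank_inf_eq R (J ^ 2)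
    rw [g.dimR] at h2
    have := g.dim3 b3 (by omega)
    omega
  have b4 : J ^ 4 ≠ ⊥ := by
    intro h
    have := g.dim_soc2 (m := 2) h
    omega
  have d4 : finrank k ↥(J ^ 4) ≠ 0 := fun h => b4 (g.bot_of h)
  have t3 : finrank k ↥(J ^ 3) ≠ finrank k ↥(J ^ 4) + 1 := fun h => g.T3 h b4 (by omega)
  have c : finrank k ↥(J ^ 2) = 5 ∨ finrank k ↥(J ^ 2) = 6 := by omega
  refine ⟨c, ?_⟩
  rcases c with c | c
  · omega
  · have c1 := g.dim3 b3 (by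
      rw [← c]
      exact Submodule.finrank_mono le_sup_right)
    have l4 : finrank k ↥(J ^ 5) < finrank k ↥(J ^ 4) := g.dim_lt (m := 4) (by norm_num) d4
    have b5 : finrank k ↥(J ^ 3) = 4 → J ^ 5 ≠ ⊥ := by
      intro h h5
      have := g.dim_soc2 (m := 3) h5
      omega
    have n42 : ¬ (finrank k ↥(J ^ 3) = 4 ∧ finrank k ↥(J ^ 4) = 2) := by
      rintro ⟨e3, e4⟩
      have d5 : finrank k ↥(J ^ 5) ≠ 0 := fun h => b5 e3 (g.bot_of h)
      have l5 : finrank k ↥(J ^ 6) < finrank k ↥(J ^ 5) := g.dim_lt (m := 5) (by norm_num) d5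
      exact g.T4 c e3 (by omega) (b5 e3) (g.bot_of (by omega))
    have n41 : ¬ (finrank k ↥(J ^ 3) = 4 ∧ finrank k ↥(J ^ 4) = 1) := by
      rintro ⟨e3, e4⟩
      exact b5 e3 (g.bot_of (by omega))
    omega

theorem layer_eq (g : Good J R s) (i : ℕ) (hi : 1 ≤ i) :
    finrank k ((J ^ i : Submodule k A) ⧸
        (Submodule.comap (J ^ i : Submodule k A).subtype (J ^ (i + 1)))) + finrank k ↥(J ^ (i + 1))
      = finrank k ↥(J ^ i) := by
  rw [← Submodule.finrank_quotient_add_finrank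
    (Submodule.comap (J ^ i : Submodule k A).subtype (J ^ (i + 1)))]
  congr 1
  exact (Submodule.comapSubtypeEquivOfLe (g.pow_anti hi (by omega))).finrank_eq.symm

end Good
end Abstract3

section LocalPart

variable (k : Type) [Field k] [IsAlgClosed k] (A : Type) [Ring A] [Algebra k A]
  [FiniteDimensional k A] [IsLocalRing A]

theorem nu_mul_left [IsArtinianRing A] (a x : A) (hx : ¬ IsUnit x) : ¬ IsUnit (a * x) := by
  intro h
  apply hx
  obtain ⟨b, hb⟩ := h.exists_left_inv
  rw [← mul_assoc] at hb
  exact IsUnit.of_mul_eq_one_right _ hb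

theorem nu_mul_right [IsArtinianRing A] (a x : A) (hx : ¬ IsUnit x) : ¬ IsUnit (x * a) := by
  intro h
  apply hx
  obtain ⟨b, hb⟩ := h.exists_right_inv
  rw [mul_assoc] at hb
  exact IsUnit.of_mul_eq_one _ hb

theorem nu_add [IsArtinianRing A] (x y : A) (hx : ¬ IsUnit x) (hy : ¬ IsUnit y) : ¬ IsUnit (x + y) := by
  intro h
  obtain ⟨b, hb⟩ := h.exists_left_inv
  rw [mul_add] at hb
  rcases IsLocalRing.isUnit_or_isUnit_of_add_one hb with h | h
  · exact nu_mul_left A b x hx h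
  · exact nu_mul_left A b y hy h

theorem mem_radSub (x : A) : x ∈ radSub k A ↔ ¬ IsUnit x := by
  have : IsArtinianRing A := IsArtinianRing.of_finite k A
  refine ⟨fun h => ?_, fun h => Submodule.subset_span h⟩
  induction h using Submodule.span_induction with
  | mem x h => exact h
  | zero => exact not_isUnit_zero
  | add x y _ _ hx hy => exact nu_add A x y hx hy
  | smul c x _ hx =>
    rw [Algebra.smul_def]
    exact nu_mul_left A _ x hx

theorem rad_top (a : A) : ∃ c : k, a - algebraMap k A c ∈ radSub k A := by
  obtain ⟨c, hc⟩ := spectrum.nonempty_of_isAlgClosed_of_finiteDimensional k a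
  refine ⟨c, ?_⟩
  rw [mem_radSub]
  rw [spectrum.mem_iff] at hc
  intro h
  apply hc
  rw [← neg_sub]
  exact h.neg

theorem rad_dim : finrank k A = finrank k (radSub k A) + 1 := by
  have h1 : radSub k A ⊔ Submodule.span k {(1 : A)} = ⊤ := by
    rw [eq_top_iff]
    intro a _
    obtain ⟨c, hc⟩ := rad_top k A a
    rw [← sub_add_cancel a (algebraMap k A c)]
    apply Submodule.add_mem_sup hc
    rw [Algebra.algebraMap_eq_smul_one]
    exact Submodule.smul_mem _ _ (Submodule.mem_span_singleton_self _)
  have h2 : radSub k A ⊓ Submodule.span k {(1 : A)} = ⊥ := by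
    rw [eq_bot_iff]
    rintro x ⟨hx, hx1⟩
    obtain ⟨c, rfl⟩ := Submodule.mem_span_singleton.1 hx1
    rw [Submodule.mem_bot]
    by_contra hc
    have hc0 : c ≠ 0 := by
      rintro rfl
      simp at hc
    have := Submodule.smul_mem _ c⁻¹ hx
    rw [smul_smul, inv_mul_cancel₀ hc0, one_smul, mem_radSub] at this
    exact this isUnit_one
  have h3 := Submodule.finrank_sup_add_finrank_inf_eq (radSub k A) (Submodule.span k {(1 : A)})
  rw [h1, h2, finrank_top, finrank_bot, finrank_span_singleton one_ne_zero] at h3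
  omega

theorem rad_nil : ∃ m, radSub k A ^ m = ⊥ := by
  have : IsArtinianRing A := IsArtinianRing.of_finite k A
  obtain ⟨m, hm⟩ := IsSemiprimaryRing.isNilpotent (R := A)
  have h1 : ∀ x ∈ radSub k A, x ∈ Ring.jacobson A := by
    intro x hx
    rw [mem_radSub] at hx
    rw [← Ideal.jacobson_bot, Ideal.mem_jacobson_iff]
    intro y
    have hu : IsUnit (y * x + 1) := by
      by_contra h
      have h2 := nu_mul_left A (-y) x hx
      have := nu_add A _ _ h h2
      apply this
      rw [show y * x + 1 + -y * x = 1 by noncomm_ring]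
      exact isUnit_one
    obtain ⟨z, hz⟩ := hu.exists_left_inv
    refine ⟨z, ?_⟩
    rw [Ideal.mem_bot, ← hz]
    noncomm_ring
  have h2 : ∀ n, ∀ x ∈ radSub k A ^ (n + 1), x ∈ Ring.jacobson A ^ (n + 1) := by
    intro n
    induction n with
    | zero =>
      intro x hx
      rw [zero_add, pow_one] at hx
      rw [zero_add, Submodule.pow_one]
      exact h1 x hx
    | succ n ih =>
      intro x hx
      rw [pow_succ] at hx
      rw [Submodule.pow_succ]
      induction hx using Submodule.mul_induction_on' with
      | mem_mul_mem a ha b hb => exact Ideal.mul_mem_mul (ih a ha) (h1 b hb)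
      | add a _ b _ ha hb => exact add_mem ha hb
  refine ⟨m + 1, ?_⟩
  rw [eq_bot_iff]
  intro x hx
  have := h2 m x hx
  rw [Submodule.pow_succ, hm] at this
  simpa using this

end LocalPart

section CenterB

open Matrix Kronecker

variable (k : Type) [Field k]

theorem xB_cube : xB k ^ 3 = 0 := by
  rw [xB, ← map_pow, ← map_zero (RingQuot.mkAlgHom k (Brel k))]
  exact RingQuot.mkAlgHom_rel k ⟨rfl, Or.inl rfl⟩

theorem yB_cube : yB k ^ 3 = 0 := by
  rw [yB, ← map_pow, ← map_zero (RingQuot.mkAlgHom k (Brel k))]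
  exact RingQuot.mkAlgHom_rel k ⟨rfl, Or.inr (Or.inl rfl)⟩

theorem xyB : yB k * xB k = (-1 : k) • (xB k * yB k) := by
  have h : xB k * yB k + yB k * xB k = 0 := by
    rw [xB, yB, ← map_mul, ← map_mul, ← map_add, ← map_zero (RingQuot.mkAlgHom k (Brel k))]
    exact RingQuot.mkAlgHom_rel k ⟨rfl, Or.inr (Or.inr rfl)⟩
  have h2 : xB k * yB k + (-1 : k) • (xB k * yB k) = 0 := by
    have := add_smul (1 : k) (-1) (xB k * yB k)
    rw [add_neg_cancel, zero_smul, one_smul] at this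
    exact this.symm
  exact add_left_cancel (h.trans h2.symm)

theorem yxpow (i : ℕ) : yB k * xB k ^ i = (-1 : k) ^ i • (xB k ^ i * yB k) := by
  induction i with
  | zero => simp
  | succ i ih =>
    rw [pow_succ, ← mul_assoc, ih, smul_mul_assoc, mul_assoc, xyB, mul_smul_comm, ← mul_assoc,
      smul_smul, ← pow_succ]

theorem B_induct (S : Subalgebra k (Balg k)) (hx : xB k ∈ S) (hy : yB k ∈ S) (b : Balg k) :
    b ∈ S := by
  obtain ⟨f, rfl⟩ := RingQuot.mkAlgHom_surjective k (Brel k) b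
  induction f using FreeAlgebra.induction with
  | grade0 r =>
    rw [AlgHom.commutes]
    exact S.algebraMap_mem r
  | grade1 i =>
    fin_cases i
    · exact hx
    · exact hy
  | mul a b ha hb =>
    rw [map_mul]
    exact S.mul_mem ha hb
  | add a b ha hb =>
    rw [map_add]
    exact S.add_mem ha hb

/-- span of the monomials -/
def monSpan : Submodule k (Balg k) :=
  Submodule.span k (Set.range fun p : Fin 3 × Fin 3 => xB k ^ (p.1 : ℕ) * yB k ^ (p.2 : ℕ))

theorem mon_mem (i j : ℕ) : xB k ^ i * yB k ^ j ∈ monSpan k := by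
  by_cases hi : i < 3
  · by_cases hj : j < 3
    · exact Submodule.subset_span ⟨(⟨i, hi⟩, ⟨j, hj⟩), rfl⟩
    · rw [pow_eq_zero_of_le (by omega) (yB_cube k), mul_zero]
      exact zero_mem _
  · rw [pow_eq_zero_of_le (by omega) (xB_cube k), zero_mul]
    exact zero_mem _

theorem monSpan_top (b : Balg k) : b ∈ monSpan k := by
  let S : Subalgebra k (Balg k) :=
    { carrier := {b | ∀ t ∈ monSpan k, b * t ∈ monSpan k}
      mul_mem' := by
        intro a b ha hb t ht
        rw [mul_assoc]
        exact ha _ (hb t ht)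
      add_mem' := by
        intro a b ha hb t ht
        rw [add_mul]
        exact add_mem (ha t ht) (hb t ht)
      algebraMap_mem' := by
        intro r t ht
        rw [← Algebra.smul_def]
        exact Submodule.smul_mem _ _ ht }
  have hx : xB k ∈ S := by
    intro t ht
    induction ht using Submodule.span_induction with
    | mem x h =>
      obtain ⟨p, rfl⟩ := h
      simp only
      rw [← mul_assoc, ← pow_succ']
      exact mon_mem k _ _
    | zero => rw [mul_zero]; exact zero_mem _
    | add x y _ _ h1 h2 => rw [mul_add]; exact add_mem h1 h2
    | smul c x _ h => rw [mul_smul_comm]; exact Submodule.smul_mem _ _ h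
  have hy : yB k ∈ S := by
    intro t ht
    induction ht using Submodule.span_induction with
    | mem x h =>
      obtain ⟨p, rfl⟩ := h
      simp only
      rw [← mul_assoc, yxpow, smul_mul_assoc, mul_assoc, ← pow_succ']
      exact Submodule.smul_mem _ _ (mon_mem k _ _)
    | zero => rw [mul_zero]; exact zero_mem _
    | add x y _ _ h1 h2 => rw [mul_add]; exact add_mem h1 h2
    | smul c x _ h => rw [mul_smul_comm]; exact Submodule.smul_mem _ _ h
  have h1 : (1 : Balg k) ∈ monSpan k := by simpa using mon_mem k 0 0
  have := B_induct k S hx hy b 1 h1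
  rwa [mul_one] at this

/-- nilpotent shift -/
def NN : Matrix (Fin 3) (Fin 3) k := !![0, 0, 0; 1, 0, 0; 0, 1, 0]

/-- sign matrix -/
def DD : Matrix (Fin 3) (Fin 3) k := !![1, 0, 0; 0, -1, 0; 0, 0, 1]

theorem NN_cube : NN k ^ 3 = 0 := by
  ext i j
  fin_cases i <;> fin_cases j <;> simp [NN, pow_succ, Matrix.mul_apply, Fin.sum_univ_three]

theorem ND : NN k * DD k + DD k * NN k = 0 := by
  ext i j
  fin_cases i <;> fin_cases j <;> simp [NN, DD, Matrix.mul_apply, Fin.sum_univ_three]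

theorem kron_pow (P Q : Matrix (Fin 3) (Fin 3) k) (n : ℕ) :
    (P ⊗ₖ Q) ^ n = (P ^ n) ⊗ₖ (Q ^ n) := by
  induction n with
  | zero => simp
  | succ n ih => rw [pow_succ, ih, ← Matrix.mul_kronecker_mul, ← pow_succ, ← pow_succ]

/-- the faithful representation -/
def repF : FreeAlgebra k (Fin 2) →ₐ[k] Matrix (Fin 3 × Fin 3) (Fin 3 × Fin 3) k :=
  FreeAlgebra.lift k ![NN k ⊗ₖ 1, DD k ⊗ₖ NN k]

theorem repF_rel : ∀ ⦃a b : FreeAlgebra k (Fin 2)⦄, Brel k a b → repF k a = repF k b := by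
  rintro a b ⟨rfl, rfl | rfl | rfl⟩
  · simp [repF, kron_pow, NN_cube]
  · simp [repF, kron_pow, NN_cube]
  · simp only [repF, map_add, map_mul, FreeAlgebra.lift_ι_apply, map_zero]
    simp only [Matrix.cons_val_zero, Matrix.cons_val_one]
    rw [← Matrix.mul_kronecker_mul, ← Matrix.mul_kronecker_mul, one_mul, mul_one,
      ← Matrix.add_kronecker, ND, Matrix.zero_kronecker]

/-- the faithful representation -/
def repB : Balg k →ₐ[k] Matrix (Fin 3 × Fin 3) (Fin 3 × Fin 3) k :=
  RingQuot.liftAlgHom k ⟨repF k, repF_rel k⟩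

theorem repB_x : repB k (xB k) = NN k ⊗ₖ 1 := by
  rw [repB, xB, RingQuot.liftAlgHom_mkAlgHom_apply]
  simp [repF]

theorem repB_y : repB k (yB k) = DD k ⊗ₖ NN k := by
  rw [repB, yB, RingQuot.liftAlgHom_mkAlgHom_apply]
  simp [repF]

/-- coordinates -/
def cf (i j : Fin 3) : Balg k →ₗ[k] k :=
  (Matrix.entryLinearMap k k (i, j) ((0 : Fin 3), (0 : Fin 3))).comp (repB k).toLinearMap

theorem cf_mon (i j a b : Fin 3) : cf k i j (xB k ^ (a : ℕ) * yB k ^ (b : ℕ)) =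
    if i = a ∧ j = b then 1 else 0 := by
  have : cf k i j (xB k ^ (a : ℕ) * yB k ^ (b : ℕ)) =
    ((NN k ^ (a : ℕ) * DD k ^ (b : ℕ)) i 0) * ((NN k ^ (b : ℕ)) j 0) := by
    simp only [cf, LinearMap.comp_apply, AlgHom.toLinearMap_apply, map_mul, map_pow, repB_x, repB_y,
      kron_pow, one_pow, ← Matrix.mul_kronecker_mul, one_mul, Matrix.entryLinearMap_apply,
      Matrix.kronecker_apply]
  rw [this]
  have h1 : (NN k ^ (a : ℕ) * DD k ^ (b : ℕ)) i 0 = if i = a then 1 else 0 := by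
    fin_cases a <;> fin_cases b <;> fin_cases i <;>
      simp [NN, DD, pow_succ, Matrix.mul_apply, Fin.sum_univ_three]
  have h2 : (NN k ^ (b : ℕ)) j 0 = if j = b then 1 else 0 := by
    fin_cases b <;> fin_cases j <;>
      simp [NN, DD, pow_succ, Matrix.mul_apply, Fin.sum_univ_three]
  rw [h1, h2]
  split_ifs <;> simp_all

theorem B_expand (b : Balg k) : b = ∑ i, ∑ j, cf k i j b • (xB k ^ (i : ℕ) * yB k ^ (j : ℕ)) := by
  have := monSpan_top k b
  induction this using Submodule.span_induction with
  | mem x h =>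
    obtain ⟨⟨a, b⟩, rfl⟩ := h
    simp only [cf_mon]
    rw [Finset.sum_eq_single a, Finset.sum_eq_single b]
    · simp
    · intro j _ hj
      simp [hj]
    · simp
    · intro i _ hi
      simp [hi]
    · simp
  | zero => simp
  | add x y _ _ h1 h2 =>
    conv_lhs => rw [h1, h2]
    simp only [map_add, add_smul, Finset.sum_add_distrib]
  | smul c x _ h =>
    conv_lhs => rw [h]
    simp only [map_smul, smul_eq_mul, mul_smul, Finset.smul_sum]

end CenterB

section CenterB2

set_option linter.unusedSectionVars false

variable (k : Type) [Field k] [CharP k 3]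

/-- abstract description of the algebra `Z(B)` -/
structure CB (k Z : Type) [Field k] [Ring Z] [Algebra k Z] (u v w y t : Z) : Prop where
  spn : ∀ z : Z, ∃ c0 c1 c2 c3 c4 c5 : k,
    z = c0 • 1 + c1 • u + c2 • v + c3 • w + c4 • y + c5 • t
  ind : ∀ c0 c1 c2 c3 c4 c5 : k, c0 • 1 + c1 • u + c2 • v + c3 • w + c4 • y + c5 • t = 0 →
    c0 = 0 ∧ c1 = 0 ∧ c2 = 0 ∧ c3 = 0 ∧ c4 = 0 ∧ c5 = 0
  uu : u * u = 0
  uv : u * v = t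
  uw : u * w = 0
  uy : u * y = 0
  ut : u * t = 0
  vv : v * v = 0
  vw : v * w = 0
  vy : v * y = 0
  vt : v * t = 0
  ww : w * w = 0
  wy : w * y = 0
  wt : w * t = 0
  yy : y * y = 0
  yt : y * t = 0
  tt : t * t = 0

theorem mon_mul (a b c d : ℕ) : (xB k ^ a * yB k ^ b) * (xB k ^ c * yB k ^ d) =
    (-1 : k) ^ (b * c) • (xB k ^ (a + c) * yB k ^ (b + d)) := by
  have h : yB k ^ b * xB k ^ c = (-1 : k) ^ (b * c) • (xB k ^ c * yB k ^ b) := by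
    induction b with
    | zero => simp
    | succ b ih =>
      rw [pow_succ', mul_assoc, ih, mul_smul_comm, ← mul_assoc, yxpow, smul_mul_assoc, smul_smul,
        mul_assoc, ← pow_add]
      congr 2
      ring
  rw [mul_assoc, ← mul_assoc (yB k ^ b), h, smul_mul_assoc, mul_smul_comm, mul_assoc (xB k ^ c),
    ← pow_add, ← mul_assoc, ← pow_add]

theorem mon_zero (a b : ℕ) (h : 3 ≤ a ∨ 3 ≤ b) : xB k ^ a * yB k ^ b = 0 := by
  rcases h with h | h
  · rw [pow_eq_zero_of_le h (xB_cube k), zero_mul]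
  · rw [pow_eq_zero_of_le h (yB_cube k), mul_zero]

theorem mon_cen (a b : ℕ) (h : (2 ≤ a ∨ Even b) ∧ (2 ≤ b ∨ Even a)) :
    xB k ^ a * yB k ^ b ∈ Subalgebra.center k (Balg k) := by
  rw [Subalgebra.mem_center_iff]
  intro c
  have hS := B_induct k (Subalgebra.centralizer k {xB k ^ a * yB k ^ b}) ?_ ?_ c
  · rw [Subalgebra.mem_centralizer_iff] at hS
    exact (hS _ rfl).symm
  · rw [Subalgebra.mem_centralizer_iff]
    rintro _ rfl
    have h1 := mon_mul k a b 1 0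
    have h2 := mon_mul k 1 0 a b
    simp only [pow_one, pow_zero, mul_one, zero_mul, one_smul, add_zero, zero_add] at h1 h2
    rw [h1, h2]
    rcases h.1 with h | h
    · rw [mon_zero k _ _ (Or.inl (by omega)), mon_zero k _ _ (Or.inl (by omega)), smul_zero]
    · rw [h.neg_one_pow, one_smul, add_comm]
  · rw [Subalgebra.mem_centralizer_iff]
    rintro _ rfl
    have h1 := mon_mul k a b 0 1
    have h2 := mon_mul k 0 1 a b
    simp only [pow_one, pow_zero, one_mul, mul_zero, one_smul, add_zero, zero_add] at h1 h2
    rw [h1, h2]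
    rcases h.2 with h | h
    · rw [mon_zero k _ _ (Or.inr (by omega)), mon_zero k _ _ (Or.inr (by omega)), smul_zero]
    · rw [h.neg_one_pow, one_smul, add_comm]

theorem cf_mon' (i j : Fin 3) (a b : ℕ) : cf k i j (xB k ^ a * yB k ^ b) =
    if (i : ℕ) = a ∧ (j : ℕ) = b then 1 else 0 := by
  by_cases h : 3 ≤ a ∨ 3 ≤ b
  · rw [mon_zero k a b h, map_zero, if_neg]
    omega
  · push Not at h
    have := cf_mon k i j ⟨a, h.1⟩ ⟨b, h.2⟩
    simp only [Fin.ext_iff] at this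
    exact this

/-- expansion with nine terms -/
theorem B_expand' (z : Balg k) : z = cf k 0 0 z • (xB k ^ 0 * yB k ^ 0) +
    cf k 0 1 z • (xB k ^ 0 * yB k ^ 1) + cf k 0 2 z • (xB k ^ 0 * yB k ^ 2) +
    cf k 1 0 z • (xB k ^ 1 * yB k ^ 0) + cf k 1 1 z • (xB k ^ 1 * yB k ^ 1) +
    cf k 1 2 z • (xB k ^ 1 * yB k ^ 2) + cf k 2 0 z • (xB k ^ 2 * yB k ^ 0) +
    cf k 2 1 z • (xB k ^ 2 * yB k ^ 1) + cf k 2 2 z • (xB k ^ 2 * yB k ^ 2) := by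
  conv_lhs => rw [B_expand k z]
  simp only [Fin.sum_univ_three, ← add_assoc]
  rfl

theorem self_neg (c : k) (h : c = -c) : c = 0 := by
  have h2 : (2 : k) ≠ 0 := by
    intro h
    have : ((2 : ℕ) : k) = 0 := by exact_mod_cast h
    rw [CharP.cast_eq_zero_iff k 3] at this
    omega
  have : 2 * c = 0 := by linear_combination h
  exact (mul_eq_zero.1 this).resolve_left h2

theorem cen_coef (z : Balg k) (hz : z ∈ Subalgebra.center k (Balg k)) :
    cf k 0 1 z = 0 ∧ cf k 1 0 z = 0 ∧ cf k 1 1 z = 0 := by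
  rw [Subalgebra.mem_center_iff] at hz
  have hx := hz (xB k ^ 1 * yB k ^ 0)
  have hy := hz (xB k ^ 0 * yB k ^ 1)
  have e := B_expand' k z
  refine ⟨?_, ?_, ?_⟩
  · apply self_neg k
    have := congrArg (cf k 1 1) hx
    rw [e] at this
    simp only [mul_add, add_mul, smul_mul_assoc, mul_smul_comm, mon_mul, map_add, map_smul, cf_mon']
      at this
    simpa using this
  · apply self_neg k
    have := congrArg (cf k 1 1) hy
    rw [e] at this
    simp only [mul_add, add_mul, smul_mul_assoc, mul_smul_comm, mon_mul, map_add, map_smul, cf_mon']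
      at this
    simpa using this.symm
  · apply self_neg k
    have := congrArg (cf k 2 1) hx
    rw [e] at this
    simp only [mul_add, add_mul, smul_mul_assoc, mul_smul_comm, mon_mul, map_add, map_smul, cf_mon']
      at this
    simpa using this

theorem centerB : ∃ u v w y t, CB k (Subalgebra.center k (Balg k)) u v w y t := by
  refine ⟨⟨_, mon_cen k 2 0 (by decide)⟩, ⟨_, mon_cen k 0 2 (by decide)⟩,
    ⟨_, mon_cen k 2 1 (by decide)⟩, ⟨_, mon_cen k 1 2 (by decide)⟩,
    ⟨_, mon_cen k 2 2 (by decide)⟩, ?_⟩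
  constructor
  · rintro ⟨z, hz⟩
    refine ⟨cf k 0 0 z, cf k 2 0 z, cf k 0 2 z, cf k 2 1 z, cf k 1 2 z, cf k 2 2 z, ?_⟩
    obtain ⟨h1, h2, h3⟩ := cen_coef k z hz
    apply Subtype.ext
    have e := B_expand' k z
    rw [h1, h2, h3] at e
    simp only [zero_smul, add_zero] at e
    refine e.trans ?_
    have : (1 : Balg k) = xB k ^ 0 * yB k ^ 0 := by rw [pow_zero, pow_zero, mul_one]
    simp only [Subalgebra.coe_add, Subalgebra.coe_smul, Subalgebra.coe_one]
    rw [this]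
    module
  · intro c0 c1 c2 c3 c4 c5 h
    have h := congrArg Subtype.val h
    have e1 : (1 : Balg k) = xB k ^ 0 * yB k ^ 0 := by rw [pow_zero, pow_zero, mul_one]
    simp only [Subalgebra.coe_add, Subalgebra.coe_smul, Subalgebra.coe_one, Subalgebra.coe_zero]
      at h
    rw [e1] at h
    have h' : ∀ i j, _ := fun i j => congrArg (cf k i j) h
    simp only [map_add, map_smul, cf_mon', map_zero] at h'
    refine ⟨?_, ?_, ?_, ?_, ?_, ?_⟩
    · simpa using h' 0 0
    · simpa using h' 2 0
    · simpa using h' 0 2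
    · simpa using h' 2 1
    · simpa using h' 1 2
    · simpa using h' 2 2
  all_goals
    apply Subtype.ext
    simp only [Subalgebra.coe_mul, Subalgebra.coe_zero]
    rw [mon_mul]
  case uv => simp
  all_goals
    rw [mon_zero k _ _ (by omega), smul_zero]

end CenterB2

section Assemble

variable {k : Type} [Field k] [CharP k 3] [IsAlgClosed k]
    {A : Type} [Ring A] [Algebra k A] [FiniteDimensional k A] [IsLocalRing A]

theorem CB.map {k Z Z' : Type} [Field k] [Ring Z] [Algebra k Z] [Ring Z'] [Algebra k Z']
    (f : Z ≃ₐ[k] Z') {u v w y t : Z} (h : CB k Z u v w y t) :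
    CB k Z' (f u) (f v) (f w) (f y) (f t) := by
  constructor
  · intro z
    obtain ⟨c0, c1, c2, c3, c4, c5, hz⟩ := h.spn (f.symm z)
    refine ⟨c0, c1, c2, c3, c4, c5, ?_⟩
    rw [← f.apply_symm_apply z, hz]
    simp only [map_add, map_smul, map_one]
  · intro c0 c1 c2 c3 c4 c5 hc
    apply h.ind
    apply f.injective
    simpa only [map_add, map_smul, map_one, map_zero] using hc
  case uv => rw [← map_mul, h.uv]
  all_goals
    rw [← map_mul]
    simp [h.uu, h.uw, h.uy, h.ut, h.vv, h.vw, h.vy, h.vt, h.ww, h.wy, h.wt, h.yy, h.yt, h.tt]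

/-- product of two elements of the radical of the center -/
theorem CB.mul {k Z : Type} [Field k] [CommRing Z] [Algebra k Z] {u v w y t : Z}
    (h : CB k Z u v w y t) (c1 c2 c3 c4 c5 d1 d2 d3 d4 d5 : k) :
    (c1 • u + c2 • v + c3 • w + c4 • y + c5 • t) * (d1 • u + d2 • v + d3 • w + d4 • y + d5 • t) =
      (c1 * d2 + c2 * d1) • t := by
  have e1 := mul_comm v u
  have e2 := mul_comm w u
  have e3 := mul_comm w v
  have e4 := mul_comm y u
  have e5 := mul_comm y v
  have e6 := mul_comm y w
  have e7 := mul_comm t u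
  have e8 := mul_comm t v
  have e9 := mul_comm t w
  have e10 := mul_comm t y
  rw [h.uv] at e1
  rw [h.uw] at e2
  rw [h.vw] at e3
  rw [h.uy] at e4
  rw [h.vy] at e5
  rw [h.wy] at e6
  rw [h.ut] at e7
  rw [h.vt] at e8
  rw [h.wt] at e9
  rw [h.yt] at e10
  simp only [mul_add, add_mul, smul_mul_assoc, mul_smul_comm, h.uv, h.uu, h.uw, h.uy, h.ut, h.vv,
    h.vw, h.vy, h.vt, h.ww, h.wy, h.wt, h.yy, h.yt, h.tt, e1, e2, e3, e4, e5, e6, e7, e8, e9, e10,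
    smul_zero, add_zero, zero_add]
  module

theorem exists_good (hsym : IsSymmAlg k A) (hdim : finrank k A = 9)
    (hcen : Nonempty (Subalgebra.center k A ≃ₐ[k] Subalgebra.center k (Balg k))) :
    ∃ (R : Submodule k A) (s : A →ₗ[k] k), Good (radSub k A) R s := by
  obtain ⟨f⟩ := hcen
  obtain ⟨u0, v0, w0, y0, t0, h0⟩ := centerB k
  have h := h0.map f.symm
  generalize f.symm u0 = u at h
  generalize f.symm v0 = v at h
  generalize f.symm w0 = w at h
  generalize f.symm y0 = y at h
  generalize f.symm t0 = t at h
  obtain ⟨s, hs, hnd⟩ := hsym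
  have : IsArtinianRing A := IsArtinianRing.of_finite k A
  let e : Fin 5 → A := ![u, v, w, y, t]
  have hR : ∀ x, x ∈ Submodule.span k (Set.range e) ↔ ∃ c1 c2 c3 c4 c5 : k,
      x = ((c1 • u + c2 • v + c3 • w + c4 • y + c5 • t : Subalgebra.center k A) : A) := by
    intro x
    rw [Submodule.mem_span_range_iff_exists_fun]
    constructor
    · rintro ⟨c, rfl⟩
      refine ⟨c 0, c 1, c 2, c 3, c 4, ?_⟩
      simp [Fin.sum_univ_five, e]
    · rintro ⟨c1, c2, c3, c4, c5, rfl⟩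
      refine ⟨![c1, c2, c3, c4, c5], ?_⟩
      simp [Fin.sum_univ_five, e]
  have hRJ : Submodule.span k (Set.range e) ≤ radSub k A := by
    intro x hx
    obtain ⟨c1, c2, c3, c4, c5, rfl⟩ := (hR x).1 hx
    rw [mem_radSub]
    set r := c1 • u + c2 • v + c3 • w + c4 • y + c5 • t with hr
    have e1 : r * r * (r * r) = 0 := by
      rw [hr, h.mul, smul_mul_smul_comm, h.tt, smul_zero]
    intro hu
    have e2 : (r : A) * r * (r * r) = 0 := congrArg Subtype.val e1
    have h3 := (hu.mul hu).mul (hu.mul hu)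
    rw [e2] at h3
    exact not_isUnit_zero h3
  refine ⟨Submodule.span k (Set.range e), s, ?_⟩
  have hli : LinearIndependent k e := by
    rw [Fintype.linearIndependent_iff]
    intro c hc
    have h1 : (0 : k) • (1 : Subalgebra.center k A) + c 0 • u + c 1 • v + c 2 • w + c 3 • y
        + c 4 • t = 0 := by
      apply Subtype.ext
      simpa [Fin.sum_univ_five, e] using hc
    obtain ⟨_, a1, a2, a3, a4, a5⟩ := h.ind _ _ _ _ _ _ h1
    intro i
    fin_cases i <;> assumption
  constructor
  · exact rad_top k A
  · intro a x hx
    rw [mem_radSub] at hx ⊢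
    exact nu_mul_left A a x hx
  · intro a x hx
    rw [mem_radSub] at hx ⊢
    exact nu_mul_right A a x hx
  · exact rad_nil k A
  · exact hs
  · intro x hx
    have := hnd (Ideal.span {x}) (by
      intro z hz
      obtain ⟨a, rfl⟩ := Ideal.mem_span_singleton'.1 hz
      exact hx a)
    rwa [Ideal.span_singleton_eq_bot] at this
  · exact hdim
  · have := rad_dim k A
    omega
  · exact hRJ
  · intro r hr a
    obtain ⟨c1, c2, c3, c4, c5, rfl⟩ := (hR r).1 hr
    exact (Subalgebra.mem_center_iff.1 (Subtype.property _) a).symm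
  · intro z hz hzc
    obtain ⟨c0, c1, c2, c3, c4, c5, hc⟩ := h.spn
      ⟨z, Subalgebra.mem_center_iff.2 fun a => (hzc a).symm⟩
    have hc' : z = c0 • (1 : A) +
        ((c1 • u + c2 • v + c3 • w + c4 • y + c5 • t : Subalgebra.center k A) : A) := by
      have := congrArg Subtype.val hc
      simp only [Subalgebra.coe_add, Subalgebra.coe_smul, Subalgebra.coe_one] at this ⊢
      rw [this]
      module
    have hr := (hR _).2 ⟨c1, c2, c3, c4, c5, rfl⟩
    have h1 : c0 • (1 : A) ∈ radSub k A := by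
      have := sub_mem hz (hRJ hr)
      rwa [hc', add_sub_cancel_right] at this
    have h2 : c0 = 0 := by
      by_contra hne
      rw [mem_radSub] at h1
      apply h1
      rw [← Algebra.algebraMap_eq_smul_one]
      exact (IsUnit.mk0 c0 hne).map _
    rw [hc', h2, zero_smul, zero_add]
    exact hr
  · rw [finrank_span_eq_card hli, Fintype.card_fin]
  · refine ⟨t, ?_⟩
    intro r hr r' hr'
    obtain ⟨c1, c2, c3, c4, c5, rfl⟩ := (hR r).1 hr
    obtain ⟨d1, d2, d3, d4, d5, rfl⟩ := (hR r').1 hr'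
    exact ⟨_, congrArg Subtype.val (h.mul c1 c2 c3 c4 c5 d1 d2 d3 d4 d5)⟩
  · intro N hN hN0
    have ht : (t : A) ≠ 0 := hli.ne_zero 4
    have hle : N ≤ Submodule.span k (Set.range ![(w : A), y, t]) := by
      intro r hr
      obtain ⟨c1, c2, c3, c4, c5, rfl⟩ := (hR r).1 (hN hr)
      have hu := hN0 _ hr u (Submodule.subset_span ⟨0, rfl⟩)
      have hv := hN0 _ hr v (Submodule.subset_span ⟨1, rfl⟩)
      have m1 := congrArg Subtype.val (h.mul c1 c2 c3 c4 c5 1 0 0 0 0)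
      have m2 := congrArg Subtype.val (h.mul c1 c2 c3 c4 c5 0 1 0 0 0)
      simp only [one_smul, zero_smul, add_zero, zero_add, mul_one, mul_zero] at m1 m2
      have z2 : c2 = 0 := by
        have : c2 • (t : A) = 0 := m1.symm.trans hu
        exact (smul_eq_zero.1 this).resolve_right ht
      have z1 : c1 = 0 := by
        have : c1 • (t : A) = 0 := m2.symm.trans hv
        exact (smul_eq_zero.1 this).resolve_right ht
      rw [Submodule.mem_span_range_iff_exists_fun]
      refine ⟨![c3, c4, c5], ?_⟩
      simp [Fin.sum_univ_three, z1, z2]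
    refine (Submodule.finrank_mono hle).trans ?_
    exact (finrank_range_le_card (R := k) ![(w : A), y, t]).trans (by simp)

end Assemble

/-- The radical layer dimensions of A are (3,2,2,1) or (2,3,2,1). -/
theorem stmt17 (k : Type) [Field k] [CharP k 3] [IsAlgClosed k]
    (A : Type) [Ring A] [Algebra k A] [FiniteDimensional k A]
    [IsLocalRing A] (hsym : IsSymmAlg k A) (hdim : finrank k A = 9)
    (hcen : Nonempty (Subalgebra.center k A ≃ₐ[k] Subalgebra.center k (Balg k)))
    (layer : ℕ → ℕ)
    (hlayer : ∀ i : ℕ, layer i = finrank k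
      ((radSub k A ^ i : Submodule k A) ⧸
        (Submodule.comap (radSub k A ^ i : Submodule k A).subtype (radSub k A ^ (i + 1))))) :
    (layer 1 = 3 ∧ layer 2 = 2 ∧ layer 3 = 2 ∧ finrank k (radSub k A ^ 4 : Submodule k A) = 1) ∨
    (layer 1 = 2 ∧ layer 2 = 3 ∧ layer 3 = 2 ∧ finrank k (radSub k A ^ 4 : Submodule k A) = 1) := by
  obtain ⟨R, s, g⟩ := exists_good hsym hdim hcen
  obtain ⟨h2, h3, h4⟩ := g.main
  have l1 := g.layer_eq 1 (by norm_num)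
  have l2 := g.layer_eq 2 (by norm_num)
  have l3 := g.layer_eq 3 (by norm_num)
  rw [← hlayer] at l1 l2 l3
  have hJ : finrank k ↥(radSub k A ^ 1) = 8 := by rw [pow_one, g.dimJ]
  change _ + finrank k ↥(radSub k A ^ 2) = _ at l1
  change _ + finrank k ↥(radSub k A ^ 3) = _ at l2
  change _ + finrank k ↥(radSub k A ^ 4) = _ at l3
  omega
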